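/- There exists an infinite family of pairs (T1,T2) of unrooted binary phylogenetic trees on common label sets such that d_tw(T1,T2) = 1 while d_TBR(T1,T2) is unbounded over the family; that is, for every M ∈ ℕ there exist unrooted binary phylogenetic trees T1, T2 on a common label set X with d_tw(T1,T2) = 1 and d_TBR(T1,T2) > M. -/

import Mathlib

open SimpleGraph

/-- `G` has a tree decomposition of width at most `k`: a tree `t` together with
bags satisfying (tw1), (tw2) and (tw3), all of whose bags have size at most `k+1`. -/
def HasTreeDecompWidthLE {V : Type*} (G : SimpleGraph V) (k : ℕ) : Prop :=
  ∃ (n : ℕ) (t : SimpleGraph (Fin (n + 1))) (bag : Fin (n + 1) → Finset V),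
    t.IsTree ∧
    (∀ v : V, ∃ i, v ∈ bag i) ∧
    (∀ u v : V, G.Adj u v → ∃ i, u ∈ bag i ∧ v ∈ bag i) ∧
    (∀ v : V, (t.induce {i | v ∈ bag i}).Connected) ∧
    (∀ i, (bag i).card ≤ k + 1)

/-- The treewidth of a graph: the least `k` such that `G` has a tree decomposition
of width `k`. -/
noncomputable def treewidth {V : Type*} (G : SimpleGraph V) : ℕ :=
  sInf {k | HasTreeDecompWidthLE G k}

/-- An unrooted binary phylogenetic graph (tree or network) on label set `X`:
a finite connected graph whose degree-1 vertices are bijectively labelled by `X`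
and all of whose other vertices have degree 3. -/
structure PhyloGraph (V : Type*) (X : Type*) where
  graph : SimpleGraph V
  finite : Finite V
  connected : graph.Connected
  leaf : X → V
  leaf_inj : Function.Injective leaf
  leaf_deg : ∀ x : X, (graph.neighborSet (leaf x)).ncard = 1
  internal_deg : ∀ v : V, (∀ x : X, leaf x ≠ v) → (graph.neighborSet v).ncard = 3

/-- An unrooted binary phylogenetic tree on label set `X`. -/
structure PhyloTree (V : Type*) (X : Type*) extends PhyloGraph V X where
  acyclic : graph.IsAcyclic

open Classical in
/-- The map identifying a leaf of the second graph with the leaf of the first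
graph carrying the same label. -/
noncomputable def mergeMap {V1 V2 X : Type*} (l1 : X → V1) (l2 : X → V2) :
    V1 ⊕ V2 → V1 ⊕ V2
  | Sum.inl v => Sum.inl v
  | Sum.inr w => if h : ∃ x, l2 x = w then Sum.inl (l1 h.choose) else Sum.inr w

lemma mergeMap_idem {V1 V2 X : Type*} (l1 : X → V1) (l2 : X → V2) (u : V1 ⊕ V2) :
    mergeMap l1 l2 (mergeMap l1 l2 u) = mergeMap l1 l2 u := by
  classical
  cases u with
  | inl v => rfl
  | inr w =>
    by_cases h : ∃ x, l2 x = w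
    · simp [mergeMap, h]
    · simp [mergeMap, h]

/-- The vertex set of the display graph: the disjoint union of the vertex sets
of the two graphs, with leaves carrying the same label identified. -/
def DisplayVertex {V1 V2 X : Type*} (l1 : X → V1) (l2 : X → V2) : Type _ :=
  {u : V1 ⊕ V2 // mergeMap l1 l2 u = u}

/-- The canonical map from `V1 ⊕ V2` to the vertex set of the display graph. -/
noncomputable def toDisplay {V1 V2 X : Type*} (l1 : X → V1) (l2 : X → V2) (u : V1 ⊕ V2) :
    DisplayVertex l1 l2 :=
  ⟨mergeMap l1 l2 u, mergeMap_idem l1 l2 u⟩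

/-- The display graph of two leaf-labelled graphs: their disjoint union with the
leaves carrying the same label identified. -/
noncomputable def displayGraph {V1 V2 X : Type*} (G1 : SimpleGraph V1) (l1 : X → V1)
    (G2 : SimpleGraph V2) (l2 : X → V2) : SimpleGraph (DisplayVertex l1 l2) :=
  SimpleGraph.fromRel (fun a b =>
    (∃ u v : V1, G1.Adj u v ∧ a = toDisplay l1 l2 (Sum.inl u) ∧ b = toDisplay l1 l2 (Sum.inl v)) ∨
    (∃ u v : V2, G2.Adj u v ∧ a = toDisplay l1 l2 (Sum.inr u) ∧ b = toDisplay l1 l2 (Sum.inr v)))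

/-- The treewidth distance between two phylogenetic trees:
`d_tw(T1,T2) = tw(D(T1,T2)) - 2`. -/
noncomputable def dtw {V1 V2 X : Type*} (T1 : PhyloTree V1 X) (T2 : PhyloTree V2 X) : ℕ :=
  treewidth (displayGraph T1.graph T1.leaf T2.graph T2.leaf) - 2

/-- Two phylogenetic trees are compatible if there is a label-preserving
isomorphism between them. -/
def Compatible {V1 V2 X : Type*} (T1 : PhyloTree V1 X) (T2 : PhyloTree V2 X) : Prop :=
  ∃ φ : T1.graph ≃g T2.graph, ∀ x : X, φ (T1.leaf x) = T2.leaf x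

/-- The graph obtained from `H` by suppressing all its degree-2 vertices: its
vertices are the vertices of `H` of degree other than 2, two of them being
adjacent iff they are joined in `H` by a path all of whose internal vertices
have degree 2. -/
def Smoothing {W : Type*} (H : SimpleGraph W) :
    SimpleGraph {w : W // (H.neighborSet w).ncard ≠ 2} :=
  SimpleGraph.fromRel (fun a b =>
    ∃ p : H.Walk a.1 b.1, p.IsPath ∧
      ∀ x ∈ p.support, x = a.1 ∨ x = b.1 ∨ (H.neighborSet x).ncard = 2)

/-- `y` is an attachment point of the reattachment datum `s`: an endpoint of the
chosen edge to be subdivided (left case) or the chosen lone-leaf vertex (right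
case). -/
def attachAt {V : Type*} (s : (V × V) ⊕ V) (y : V) : Prop :=
  match s with
  | Sum.inl (p, q) => y = p ∨ y = q
  | Sum.inr v => y = v

/-- The auxiliary graph of a TBR move on `T`: the edge `{a, b}` is deleted, the
chosen edges `s1`, `s2` (one in each resulting component) are subdivided by the
two new vertices (if a component is a single leaf, the new vertex is attached to
that leaf instead), and the two new vertices are joined by an edge.  The tree
resulting from the TBR move is obtained by suppressing all degree-2 vertices of
this graph. -/
def tbrGraph {V X : Type*} (T : PhyloTree V X) (a b : V) (s1 s2 : (V × V) ⊕ V) :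
    SimpleGraph (V ⊕ Fin 2) :=
  SimpleGraph.fromRel (fun y z =>
    (∃ p q : V, T.graph.Adj p q ∧ y = Sum.inl p ∧ z = Sum.inl q ∧
      s(p, q) ≠ s(a, b) ∧
      (∀ r r' : V, s1 = Sum.inl (r, r') → s(p, q) ≠ s(r, r')) ∧
      (∀ r r' : V, s2 = Sum.inl (r, r') → s(p, q) ≠ s(r, r'))) ∨
    (∃ p : V, y = Sum.inl p ∧ z = Sum.inr 0 ∧ attachAt s1 p) ∨
    (∃ p : V, y = Sum.inl p ∧ z = Sum.inr 1 ∧ attachAt s2 p) ∨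
    (y = Sum.inr 0 ∧ z = Sum.inr 1))

/-- Validity of the reattachment datum `s` for the component of `c` after
deleting the edge `{a, b}` of `T`: either `s` picks an edge of that component,
or the component is the single leaf `c` and `s` picks it. -/
def ValidAttach {V X : Type*} (T : PhyloTree V X) (a b c : V) (s : (V × V) ⊕ V) : Prop :=
  match s with
  | Sum.inl (p, q) => T.graph.Adj p q ∧
      (T.graph.deleteEdges {s(a, b)}).Reachable c p ∧
      (T.graph.deleteEdges {s(a, b)}).Reachable c q
  | Sum.inr v => v = c ∧ ∃ x, T.leaf x = c

/-- `T'` is obtained from `T` by a single TBR (Tree Bisection and Reconnect)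
move: delete an edge `{a,b}`, subdivide a chosen edge in each of the two
resulting components (or use the component itself if it is a single leaf), join
the two subdivision vertices by a new edge and suppress all degree-2 vertices. -/
def TBRStep {V V' : Type} {X : Type} (T : PhyloTree V X) (T' : PhyloTree V' X) : Prop :=
  ∃ (a b : V) (s1 s2 : (V × V) ⊕ V),
    T.graph.Adj a b ∧ ValidAttach T a b a s1 ∧ ValidAttach T a b b s2 ∧
    ∃ e : T'.graph ≃g Smoothing (tbrGraph T a b s1 s2),
      ∀ x : X, ((e (T'.leaf x)).1 : V ⊕ Fin 2) = Sum.inl (T.leaf x)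

/-- Phylogenetic trees on the label set `X` (with arbitrary vertex type). -/
def PTree (X : Type) : Type 1 := Σ V : Type, PhyloTree V X

/-- `tbrChain n A B` holds if the tree `B` can be obtained from the tree `A` by
(at most) `n` TBR moves (identifying label-isomorphic trees). -/
def tbrChain {X : Type} : ℕ → PTree X → PTree X → Prop
  | 0, A, B => Compatible A.2 B.2
  | n + 1, A, B => ∃ C : PTree X, TBRStep A.2 C.2 ∧ tbrChain n C B

/-- The TBR distance between two phylogenetic trees on the same label set: the
minimum number of TBR moves needed to transform one into the other. -/
noncomputable def dTBR {V1 V2 X : Type} (T1 : PhyloTree V1 X) (T2 : PhyloTree V2 X) : ℕ :=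
  sInf {n | tbrChain n ⟨V1, T1⟩ ⟨V2, T2⟩}


/-- Monochromatic subgraph. -/
def monoG {V : Type*} (G : SimpleGraph V) (c : V → ℕ) : SimpleGraph V where
  Adj u v := G.Adj u v ∧ c u = c v
  symm := ⟨fun _ _ h => ⟨h.1.symm, h.2.symm⟩⟩
  loopless := ⟨fun _ h => G.loopless.irrefl _ h.1⟩

lemma reach_invariant {V : Type*} {G : SimpleGraph V} (P : V → Prop)
    (hP : ∀ u v, G.Adj u v → P u → P v) {u v : V} (h : G.Reachable u v) (hu : P u) : P v := by
  obtain ⟨p⟩ := h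
  induction p with
  | nil => exact hu
  | cons h p ih => exact ih (hP _ _ h hu)

lemma monoG_reach_color {V : Type*} {G : SimpleGraph V} {c : V → ℕ} {u v : V}
    (h : (monoG G c).Reachable u v) : c u = c v :=
  reach_invariant (G := monoG G c) (fun w => c u = c w) (fun _ _ h hu => hu.trans h.2) h rfl

/-- A colouring with connected colour classes. -/
def ConnCol {V : Type*} (G : SimpleGraph V) (c : V → ℕ) : Prop :=
  ∀ u v, c u = c v → (monoG G c).Reachable u v

/-- The tree has a partition in `k` connected classes refining the character `f`. -/
def Good {V X : Type*} (G : SimpleGraph V) (leaf : X → V) (f : X → ℕ) (k : ℕ) : Prop :=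
  ∃ c : V → ℕ, (∀ v, c v < k) ∧ ConnCol G c ∧ ∀ x y, c (leaf x) = c (leaf y) → f x = f y

open Classical in
lemma connCol_delete {V : Type*} {G : SimpleGraph V} {c : V → ℕ} (hc : ConnCol G c) (k : ℕ)
    (hk : ∀ v, c v < k) (a b : V) :
    ∃ c' : V → ℕ, (∀ v, c' v < k + 1) ∧ ConnCol (G.deleteEdges {s(a, b)}) c' ∧
      ∀ u v, c' u = c' v → c u = c v := by
  set G0 := G.deleteEdges {s(a, b)} with hG0
  let S : Set V := {v | (monoG G0 c).Reachable b v}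
  have hbS : b ∈ S := Reachable.refl _
  have hS : ∀ u v, (monoG G0 c).Adj u v → (u ∈ S ↔ v ∈ S) := fun u v h =>
    ⟨fun hu => Reachable.trans hu h.reachable, fun hv => Reachable.trans hv h.symm.reachable⟩
  let c' : V → ℕ := fun v => if v ∈ S then k else c v
  have hmono : ∀ u v, (monoG G0 c).Adj u v → (monoG G0 c').Adj u v := by
    intro u v h
    refine ⟨h.1, ?_⟩
    have := hS u v h
    have h2 := h.2
    simp only [c']
    by_cases hu : u ∈ S
    · rw [if_pos hu, if_pos (this.1 hu)]
    · rw [if_neg hu, if_neg (fun hv => hu (this.2 hv)), h2]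
  have hle : monoG G0 c ≤ monoG G0 c' := fun u v h => hmono u v h
  have hmem : ∀ u v, c' u = c' v → ((u ∈ S ∧ v ∈ S) ∨ (u ∉ S ∧ v ∉ S ∧ c u = c v)) := by
    intro u v h
    simp only [c'] at h
    have h1 := hk u
    have h2 := hk v
    by_cases hu : u ∈ S <;> by_cases hv : v ∈ S <;> simp only [hu, hv, if_true, if_false] at h ⊢ <;>
      simp <;> omega
  refine ⟨c', ?_, ?_, ?_⟩
  · intro v
    have := hk v
    simp only [c']
    split_ifs <;> omega
  · intro u v huv
    rcases hmem u v huv with ⟨hu, hv⟩ | ⟨hu, hv, h⟩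
    · exact (Reachable.trans (Reachable.symm hu) hv).mono hle
    · have key := reach_invariant (G := monoG G c)
        (fun w => (w ∉ S → (monoG G0 c').Reachable u w) ∧ (w ∈ S → (monoG G0 c').Reachable u a))
        ?_ (hc u v h) ⟨fun _ => Reachable.refl _, fun h => absurd h hu⟩
      · exact key.1 hv
      · rintro x y ⟨hxy, hcol⟩ ⟨h1, h2⟩
        by_cases he : s(x, y) = s(a, b)
        · rw [Sym2.eq_iff] at he
          rcases he with ⟨rfl, rfl⟩ | ⟨rfl, rfl⟩
          · by_cases hx : x ∈ S
            · exact ⟨fun hy => absurd hbS hy, fun _ => h2 hx⟩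
            · exact ⟨fun hy => absurd hbS hy, fun _ => h1 hx⟩
          · exact ⟨fun _ => h2 hbS, fun _ => h2 hbS⟩
        · have hadj : (monoG G0 c).Adj x y := ⟨by
            rw [hG0, deleteEdges_adj]; exact ⟨hxy, by simpa using he⟩, hcol⟩
          have hiff := hS x y hadj
          exact ⟨fun hy => (h1 (fun hx => hy (hiff.1 hx))).trans (hmono _ _ hadj).reachable,
            fun hy => h2 (hiff.2 hy)⟩
  · intro u v huv
    rcases hmem u v huv with ⟨hu, hv⟩ | ⟨hu, hv, h⟩
    · exact (monoG_reach_color hu).symm.trans (monoG_reach_color hv)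
    · exact h

lemma connCol_smoothing {W : Type*} {H : SimpleGraph W} {C : W → ℕ} (hC : ConnCol H C) :
    ConnCol (Smoothing H) (fun w => C w.1) := by
  have key : ∀ (x v : W) (p : (monoG H C).Walk x v), p.IsPath →
      ∀ hv : (H.neighborSet v).ncard ≠ 2,
      ∃ (w : W) (hw : (H.neighborSet w).ncard ≠ 2) (q : H.Walk x w), q.IsPath ∧
        (∀ z ∈ q.support, z ∈ p.support) ∧
        (∀ z ∈ q.support, z = w ∨ (H.neighborSet z).ncard = 2) ∧
        (monoG (Smoothing H) (fun w => C w.1)).Reachable ⟨w, hw⟩ ⟨v, hv⟩ := by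
    intro x v p
    induction p with
    | nil =>
      intro _ hv
      exact ⟨_, hv, Walk.nil, by simp, by simp, by simp, Reachable.refl _⟩
    | @cons x y v h p ih =>
      intro hp hv
      rw [Walk.cons_isPath_iff] at hp
      obtain ⟨w, hw, q, hq, hsub, hdeg, hreach⟩ := ih hp.1 hv
      have hxq : x ∉ q.support := fun hx => hp.2 (hsub _ hx)
      have hcw : C w = C v :=
        monoG_reach_color (G := Smoothing H) (c := fun w => C w.1) hreach
      have hcy : C y = C v := monoG_reach_color ⟨p⟩
      have hcx : C x = C y := h.2
      by_cases hx : (H.neighborSet x).ncard = 2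
      · refine ⟨w, hw, Walk.cons h.1 q, ?_, ?_, ?_, hreach⟩
        · rw [Walk.cons_isPath_iff]; exact ⟨hq, hxq⟩
        · intro z hz
          simp only [Walk.support_cons, List.mem_cons] at hz ⊢
          exact hz.imp id (hsub z)
        · intro z hz
          simp only [Walk.support_cons, List.mem_cons] at hz
          rcases hz with rfl | hz
          · exact Or.inr hx
          · exact hdeg z hz
      · refine ⟨x, hx, Walk.nil, by simp, by simp, by simp, ?_⟩
        refine Reachable.trans (Adj.reachable ?_) hreach
        refine ⟨?_, by simp only; omega⟩
        rw [Smoothing, fromRel_adj]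
        refine ⟨?_, Or.inl ⟨Walk.cons h.1 q, ?_, ?_⟩⟩
        · intro he
          have : x = w := congrArg Subtype.val he
          exact hxq (this ▸ q.end_mem_support)
        · rw [Walk.cons_isPath_iff]; exact ⟨hq, hxq⟩
        · intro z hz
          simp only [Walk.support_cons, List.mem_cons] at hz
          rcases hz with rfl | hz
          · exact Or.inl rfl
          · exact Or.inr (hdeg z hz)
  classical
  rintro ⟨u, hu⟩ ⟨v, hv⟩ huv
  obtain ⟨p, hp⟩ := (hC u v huv).exists_isPath
  obtain ⟨w, hw, q, hq, hsub, hdeg, hreach⟩ := key u v p hp hv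
  have : u = w := (hdeg u q.start_mem_support).resolve_right hu
  subst this
  exact hreach

/-- A chosen attachment point. -/
def attPt {V : Type*} (s : (V × V) ⊕ V) : V :=
  match s with
  | Sum.inl (p, _) => p
  | Sum.inr v => v

lemma attachAt_attPt {V : Type*} (s : (V × V) ⊕ V) : attachAt s (attPt s) := by
  rcases s with ⟨p, q⟩ | v <;> simp [attachAt, attPt]

lemma connCol_tbrGraph {V X : Type*} (T : PhyloTree V X) (a b : V) (s1 s2 : (V × V) ⊕ V)
    {c : V → ℕ} (hc : ConnCol (T.graph.deleteEdges {s(a, b)}) c) :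
    ConnCol (tbrGraph T a b s1 s2)
      (Sum.elim c (fun i => if i = 0 then c (attPt s1) else c (attPt s2))) := by
  set C : V ⊕ Fin 2 → ℕ := Sum.elim c (fun i => if i = 0 then c (attPt s1) else c (attPt s2))
    with hCdef
  have a0 : ∀ p, attachAt s1 p → (tbrGraph T a b s1 s2).Adj (Sum.inl p) (Sum.inr 0) := by
    intro p hp
    rw [tbrGraph, fromRel_adj]
    exact ⟨by simp, Or.inl (Or.inr (Or.inl ⟨p, rfl, rfl, hp⟩))⟩
  have a1 : ∀ p, attachAt s2 p → (tbrGraph T a b s1 s2).Adj (Sum.inl p) (Sum.inr 1) := by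
    intro p hp
    rw [tbrGraph, fromRel_adj]
    exact ⟨by simp, Or.inl (Or.inr (Or.inr (Or.inl ⟨p, rfl, rfl, hp⟩)))⟩
  have m0 : ∀ p, attachAt s1 p → c p = c (attPt s1) →
      (monoG (tbrGraph T a b s1 s2) C).Adj (Sum.inl p) (Sum.inr 0) := fun p h1 h2 =>
    ⟨a0 p h1, by simp [C, h2]⟩
  have m1 : ∀ p, attachAt s2 p → c p = c (attPt s2) →
      (monoG (tbrGraph T a b s1 s2) C).Adj (Sum.inl p) (Sum.inr 1) := fun p h1 h2 =>
    ⟨a1 p h1, by simp [C, h2]⟩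
  have edge : ∀ u v, (monoG (T.graph.deleteEdges {s(a, b)}) c).Adj u v →
      (monoG (tbrGraph T a b s1 s2) C).Reachable (Sum.inl u) (Sum.inl v) := by
    rintro u v ⟨h, hcol⟩
    rw [deleteEdges_adj] at h
    by_cases h1 : ∃ r r', s1 = Sum.inl (r, r') ∧ s(u, v) = s(r, r')
    · obtain ⟨r, r', rfl, he⟩ := h1
      have hu : attachAt (Sum.inl (r, r')) u ∧ attachAt (Sum.inl (r, r')) v ∧ c u = c r ∧ c v = c r := by
        rw [Sym2.eq_iff] at he
        rcases he with ⟨rfl, rfl⟩ | ⟨rfl, rfl⟩ <;> simp [attachAt, hcol]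
      exact (m0 u hu.1 hu.2.2.1).reachable.trans (m0 v hu.2.1 hu.2.2.2).symm.reachable
    by_cases h2 : ∃ r r', s2 = Sum.inl (r, r') ∧ s(u, v) = s(r, r')
    · obtain ⟨r, r', rfl, he⟩ := h2
      have hu : attachAt (Sum.inl (r, r')) u ∧ attachAt (Sum.inl (r, r')) v ∧ c u = c r ∧ c v = c r := by
        rw [Sym2.eq_iff] at he
        rcases he with ⟨rfl, rfl⟩ | ⟨rfl, rfl⟩ <;> simp [attachAt, hcol]
      exact (m1 u hu.1 hu.2.2.1).reachable.trans (m1 v hu.2.1 hu.2.2.2).symm.reachable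
    refine Adj.reachable ⟨?_, by simpa [C] using hcol⟩
    rw [tbrGraph, fromRel_adj]
    refine ⟨by simpa using h.1.ne, Or.inl (Or.inl ⟨u, v, h.1, rfl, rfl, by simpa using h.2, ?_, ?_⟩)⟩
    · intro r r' hr he
      exact h1 ⟨r, r', hr, he⟩
    · intro r r' hr he
      exact h2 ⟨r, r', hr, he⟩
  have walk : ∀ u v, c u = c v →
      (monoG (tbrGraph T a b s1 s2) C).Reachable (Sum.inl u) (Sum.inl v) := by
    intro u v huv
    exact reach_invariant (fun w => (monoG (tbrGraph T a b s1 s2) C).Reachable (Sum.inl u) (Sum.inl w))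
      (fun x y hxy hx => hx.trans (edge x y hxy)) (hc u v huv) (Reachable.refl _)
  have rep : ∀ w : V ⊕ Fin 2, ∃ v : V, C w = c v ∧
      (monoG (tbrGraph T a b s1 s2) C).Reachable w (Sum.inl v) := by
    rintro (v | i)
    · exact ⟨v, rfl, Reachable.refl _⟩
    · fin_cases i
      · exact ⟨attPt s1, by simp [C], (m0 _ (attachAt_attPt s1) rfl).symm.reachable⟩
      · exact ⟨attPt s2, by simp [C], (m1 _ (attachAt_attPt s2) rfl).symm.reachable⟩
  intro x y hxy
  obtain ⟨u, hu, hu'⟩ := rep x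
  obtain ⟨v, hv, hv'⟩ := rep y
  exact (hu'.trans (walk u v (by rw [← hu, ← hv, hxy]))).trans hv'.symm

lemma connCol_iso {V W : Type*} {G : SimpleGraph V} {H : SimpleGraph W} (e : G ≃g H) {c : W → ℕ}
    (hc : ConnCol H c) : ConnCol G (fun v => c (e v)) := by
  intro u v huv
  have := hc (e u) (e v) huv
  have h2 := reach_invariant (fun w => (monoG G (fun v => c (e v))).Reachable u (e.symm w)) ?_ this
    (by simp)
  · simpa using h2
  · intro x y hxy hx
    refine hx.trans (Adj.reachable ⟨?_, ?_⟩)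
    · exact e.symm.map_rel_iff.2 hxy.1
    · simpa using hxy.2

lemma good_step {V V' X : Type} {T : PhyloTree V X} {T' : PhyloTree V' X} (h : TBRStep T T')
    {f : X → ℕ} {k : ℕ} (hg : Good T.graph T.leaf f k) : Good T'.graph T'.leaf f (k + 1) := by
  obtain ⟨a, b, s1, s2, -, -, -, e, he⟩ := h
  obtain ⟨c, hk, hc, hf⟩ := hg
  obtain ⟨c', hk', hc', hcc⟩ := connCol_delete hc k hk a b
  refine ⟨_, ?_, connCol_iso e (connCol_smoothing (connCol_tbrGraph T a b s1 s2 hc')), ?_⟩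
  · intro v
    generalize (e v).1 = w
    rcases w with v | i
    · exact hk' v
    · simp only [Sum.elim_inr]
      split_ifs
      · exact hk' _
      · exact hk' _
  · intro x y hxy
    simp only [he, Sum.elim_inl] at hxy
    exact hf x y (hcc _ _ hxy)

lemma good_chain {X : Type} {f : X → ℕ} (n : ℕ) : ∀ (A B : PTree X) (k : ℕ), tbrChain n A B →
    Good A.2.graph A.2.leaf f k → Good B.2.graph B.2.leaf f (k + n) := by
  induction n with
  | zero =>
    rintro A B k ⟨φ, hφ⟩ ⟨c, hk, hc, hf⟩
    refine ⟨_, ?_, connCol_iso φ.symm hc, ?_⟩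
    · intro v; exact hk _
    · intro x y hxy
      simp only [← hφ, RelIso.symm_apply_apply] at hxy
      exact hf x y hxy
  | succ n ih =>
    rintro A B k ⟨C, h1, h2⟩ hg
    have := ih C B (k + 1) h2 (good_step h1 hg)
    rwa [show k + (n + 1) = k + 1 + n by omega]


lemma smoothing_adj {W : Type*} (H : SimpleGraph W)
    (hnon : ∀ x y, (H.neighborSet x).ncard = 2 → (H.neighborSet y).ncard = 2 → ¬ H.Adj x y)
    (y z : {w : W // (H.neighborSet w).ncard ≠ 2}) :
    (Smoothing H).Adj y z ↔ y.1 ≠ z.1 ∧ (H.Adj y.1 z.1 ∨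
      ∃ d, (H.neighborSet d).ncard = 2 ∧ H.Adj y.1 d ∧ H.Adj d z.1) := by
  obtain ⟨y, hy⟩ := y
  obtain ⟨z, hz⟩ := z
  have fwd : ∀ y z : W, y ≠ z → ∀ p : H.Walk y z, p.IsPath →
      (∀ x ∈ p.support, x = y ∨ x = z ∨ (H.neighborSet x).ncard = 2) →
      (H.Adj y z ∨ ∃ d, (H.neighborSet d).ncard = 2 ∧ H.Adj y d ∧ H.Adj d z) := by
    intro y z hyz p hp hs
    match p with
    | .nil => exact absurd rfl hyz
    | .cons h .nil => exact Or.inl h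
    | .cons (v := d) h (.cons h' .nil) =>
      rcases hs d (by simp) with rfl | rfl | hd
      · exact absurd h (H.loopless.irrefl _)
      · exact Or.inl h
      · exact Or.inr ⟨d, hd, h, h'⟩
    | .cons (v := d) h (.cons (v := d') h' (.cons (v := d'') h'' r)) =>
      exfalso
      simp only [Walk.cons_isPath_iff, Walk.support_cons, List.mem_cons, not_or] at hp
      have hzr := r.end_mem_support
      have h1 : (H.neighborSet d).ncard = 2 := by
        rcases hs d (by simp) with e | rfl | hd
        · exact absurd e.symm hp.2.1
        · exact absurd hzr hp.1.2.2
        · exact hd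
      have h2 : (H.neighborSet d').ncard = 2 := by
        rcases hs d' (by simp) with e | rfl | hd
        · exact absurd e.symm hp.2.2.1
        · exact absurd hzr hp.1.1.2
        · exact hd
      exact hnon _ _ h1 h2 h'
  rw [Smoothing, fromRel_adj]
  simp only [ne_eq, Subtype.mk.injEq]
  constructor
  · rintro ⟨hne, ⟨p, hp, hs⟩ | ⟨p, hp, hs⟩⟩
    · exact ⟨hne, fwd y z hne p hp hs⟩
    · refine ⟨hne, ?_⟩
      rcases fwd z y (Ne.symm hne) p hp hs with h | ⟨d, hd, h1, h2⟩
      · exact Or.inl h.symm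
      · exact Or.inr ⟨d, hd, h2.symm, h1.symm⟩
  · rintro ⟨hne, h | ⟨d, hd, h1, h2⟩⟩
    · refine ⟨hne, Or.inl ⟨Walk.cons h Walk.nil, ?_, ?_⟩⟩
      · simp [Walk.cons_isPath_iff, hne]
      · simp
    · refine ⟨hne, Or.inl ⟨Walk.cons h1 (Walk.cons h2 Walk.nil), ?_, ?_⟩⟩
      · simp [Walk.cons_isPath_iff, hne, h1.ne, h2.ne]
      · simp [hd]

section Swap
variable {V X : Type} (T : PhyloTree V X) {p a l b l' q : V}

lemma tbrH_ll (u v : V) :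
    (tbrGraph T l a (Sum.inr l) (Sum.inl (b, q))).Adj (Sum.inl u) (Sum.inl v) ↔
      T.graph.Adj u v ∧ s(u, v) ≠ s(l, a) ∧ s(u, v) ≠ s(b, q) := by
  rw [tbrGraph, fromRel_adj]
  constructor
  · rintro ⟨-, h | h⟩
    · rcases h with ⟨p', q', h1, h2, h3, h4, -, h6⟩ | ⟨_, _, h, _⟩ | ⟨_, _, h, _⟩ | ⟨h, _⟩
      · cases h2; cases h3
        exact ⟨h1, h4, h6 _ _ rfl⟩
      all_goals cases h
    · rcases h with ⟨p', q', h1, h2, h3, h4, -, h6⟩ | ⟨_, _, h, _⟩ | ⟨_, _, h, _⟩ | ⟨h, _⟩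
      · cases h2; cases h3
        have := h6 _ _ rfl
        rw [Sym2.eq_swap] at h4 this
        exact ⟨h1.symm, h4, this⟩
      all_goals cases h
  · rintro ⟨h1, h2, h3⟩
    refine ⟨by simpa using h1.ne, Or.inl (Or.inl ⟨u, v, h1, rfl, rfl, h2, by simp, ?_⟩)⟩
    rintro r r' h
    cases h
    exact h3

lemma tbrH_l0 (u : V) :
    (tbrGraph T l a (Sum.inr l) (Sum.inl (b, q))).Adj (Sum.inl u) (Sum.inr 0) ↔ u = l := by
  rw [tbrGraph, fromRel_adj]
  simp [attachAt]

lemma tbrH_l1 (u : V) :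
    (tbrGraph T l a (Sum.inr l) (Sum.inl (b, q))).Adj (Sum.inl u) (Sum.inr 1) ↔ u = b ∨ u = q := by
  rw [tbrGraph, fromRel_adj]
  simp [attachAt]

lemma tbrH_01 :
    (tbrGraph T l a (Sum.inr l) (Sum.inl (b, q))).Adj (Sum.inr 0) (Sum.inr 1) := by
  rw [tbrGraph, fromRel_adj]
  simp

lemma tbrH_0l (u : V) :
    (tbrGraph T l a (Sum.inr l) (Sum.inl (b, q))).Adj (Sum.inr 0) (Sum.inl u) ↔ u = l := by
  rw [SimpleGraph.adj_comm, tbrH_l0]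

lemma tbrH_1l (u : V) :
    (tbrGraph T l a (Sum.inr l) (Sum.inl (b, q))).Adj (Sum.inr 1) (Sum.inl u) ↔ u = b ∨ u = q := by
  rw [SimpleGraph.adj_comm, tbrH_l1]

lemma tbrH_10 :
    (tbrGraph T l a (Sum.inr l) (Sum.inl (b, q))).Adj (Sum.inr 1) (Sum.inr 0) :=
  (tbrH_01 T).symm

open Classical in
set_option maxHeartbeats 2000000 in
lemma swap_iso (hne : [p, a, l, b, l', q].Nodup)
    (ha : ∀ v, T.graph.Adj a v ↔ v = p ∨ v = l ∨ v = b)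
    (hb : ∀ v, T.graph.Adj b v ↔ v = a ∨ v = l' ∨ v = q)
    (hl : ∀ v, T.graph.Adj l v ↔ v = a)
    (hl' : ∀ v, T.graph.Adj l' v ↔ v = b)
    (hdeg : ∀ v, (T.graph.neighborSet v).ncard ≠ 2) :
    ∃ e : T.graph ≃g Smoothing (tbrGraph T l a (Sum.inr l) (Sum.inl (b, q))),
      ∀ v, v ≠ a → v ≠ b → (e v).1 = Sum.inl (Equiv.swap l l' v) := by
  simp only [List.nodup_cons, List.mem_cons, not_or, List.not_mem_nil, not_false_eq_true,
    List.nodup_nil, and_true] at hne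
  obtain ⟨⟨npa, npl, npb, npl', npq⟩, ⟨nal, nab, nal', naq⟩, ⟨nlb, nll', nlq⟩, ⟨nbl', nbq⟩, nl'q⟩ := hne
  have ha2 : ∀ v, T.graph.Adj v a ↔ v = p ∨ v = l ∨ v = b := fun v => by rw [adj_comm, ha]
  have hb2 : ∀ v, T.graph.Adj v b ↔ v = a ∨ v = l' ∨ v = q := fun v => by rw [adj_comm, hb]
  have hl2 : ∀ v, T.graph.Adj v l ↔ v = a := fun v => by rw [adj_comm, hl]
  have hl2' : ∀ v, T.graph.Adj v l' ↔ v = b := fun v => by rw [adj_comm, hl']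
  set H := tbrGraph T l a (Sum.inr l) (Sum.inl (b, q)) with hH
  have Hll : ∀ u v, H.Adj (Sum.inl u) (Sum.inl v) ↔
      T.graph.Adj u v ∧ s(u, v) ≠ s(l, a) ∧ s(u, v) ≠ s(b, q) := tbrH_ll T
  have Hl0 : ∀ u, H.Adj (Sum.inl u) (Sum.inr 0) ↔ u = l := tbrH_l0 T
  have Hl1 : ∀ u, H.Adj (Sum.inl u) (Sum.inr 1) ↔ u = b ∨ u = q := tbrH_l1 T
  have H0l : ∀ u, H.Adj (Sum.inr 0) (Sum.inl u) ↔ u = l := tbrH_0l T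
  have H1l : ∀ u, H.Adj (Sum.inr 1) (Sum.inl u) ↔ u = b ∨ u = q := tbrH_1l T
  have H01 : H.Adj (Sum.inr 0) (Sum.inr 1) := tbrH_01 T
  have H10 : H.Adj (Sum.inr 1) (Sum.inr 0) := tbrH_10 T
  have Na : ∀ w, H.Adj (Sum.inl a) w ↔ w = Sum.inl p ∨ w = Sum.inl b := by
    rintro (w | i)
    · rw [Hll, ha]
      simp only [Sum.inl.injEq, ne_eq, Sym2.eq_iff]
      grind
    · fin_cases i
      · simpa using (Hl0 a).not.2 nal
      · simpa using (Hl1 a).not.2 (by simp [nab, naq])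
  have N0 : ∀ w, H.Adj (Sum.inr 0) w ↔ w = Sum.inl l ∨ w = Sum.inr 1 := by
    rintro (w | i)
    · rw [H0l]; simp
    · fin_cases i
      · simp
      · simpa using H01
  have N1 : ∀ w, H.Adj (Sum.inr 1) w ↔ w = Sum.inl b ∨ w = Sum.inl q ∨ w = Sum.inr 0 := by
    rintro (w | i)
    · rw [H1l]; simp
    · fin_cases i
      · simpa using H10
      · simp
  have da : (H.neighborSet (Sum.inl a)).ncard = 2 := by
    rw [show H.neighborSet (Sum.inl a) = {Sum.inl p, Sum.inl b} by ext w; simp [Na]]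
    exact Set.ncard_pair (by simpa using npb)
  have d0 : (H.neighborSet (Sum.inr 0)).ncard = 2 := by
    rw [show H.neighborSet (Sum.inr 0) = {Sum.inl l, Sum.inr 1} by ext w; simp [N0]]
    exact Set.ncard_pair (by simp)
  have d1 : (H.neighborSet (Sum.inr 1)).ncard ≠ 2 := by
    rw [show H.neighborSet (Sum.inr 1) = {Sum.inl b, Sum.inl q, Sum.inr 0} by ext w; simp [N1]]
    rw [Set.ncard_eq_three.2 ⟨Sum.inl b, Sum.inl q, Sum.inr 0, by simpa using nbq, by simp, by simp, rfl⟩]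
    omega
  have dv : ∀ v, v ≠ a → (H.neighborSet (Sum.inl v)).ncard ≠ 2 := by
    intro v hv
    let g : V → V ⊕ Fin 2 := fun w => if v = l then Sum.inr 0 else
      if s(v, w) = s(b, q) then Sum.inr 1 else Sum.inl w
    have : H.neighborSet (Sum.inl v) = g '' (T.graph.neighborSet v) := by
      ext w
      simp only [mem_neighborSet, Set.mem_image]
      rcases w with w | i
      · rw [Hll]
        constructor
        · rintro ⟨h1, h2, h3⟩
          refine ⟨w, h1, ?_⟩
          have : v ≠ l := by
            rintro rfl
            rw [hl] at h1
            exact h2 (by rw [h1])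
          simp only [g]
          rw [if_neg this, if_neg h3]
        · rintro ⟨w', h1, h2⟩
          simp only [g] at h2
          split_ifs at h2 with h3 h4
          cases h2
          refine ⟨h1, ?_, h4⟩
          simp only [ne_eq, Sym2.eq_iff]
          tauto
      · fin_cases i
        · simp only [Fin.zero_eta, Hl0]
          constructor
          · rintro rfl
            exact ⟨a, (hl a).2 rfl, by simp [g]⟩
          · rintro ⟨w', h1, h2⟩
            by_contra h3
            simp only [g, if_neg h3] at h2
            split_ifs at h2
            simp at h2
        · simp only [Fin.mk_one, Hl1]
          constructor
          · rintro (rfl | rfl)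
            · exact ⟨q, (hb q).2 (by simp), by simp [g, Ne.symm nlb]⟩
            · exact ⟨b, (hb2 v).2 (by simp), by simp [g, Ne.symm nlq, Sym2.eq_swap]⟩
          · rintro ⟨w', h1, h2⟩
            simp only [g] at h2
            split_ifs at h2 with h3 h4
            · simp at h2
            · rw [Sym2.eq_iff] at h4
              tauto
    rw [this, Set.InjOn.ncard_image]
    · exact hdeg v
    · intro x hx y hy hxy
      simp only [mem_neighborSet] at hx hy
      simp only [g] at hxy
      by_cases h3 : v = l
      · subst h3
        rw [hl] at hx hy
        rw [hx, hy]
      · simp only [if_neg h3] at hxy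
        split_ifs at hxy with h4 h5
        · rw [Sym2.eq_iff] at h4 h5
          grind
        · exact Sum.inl.inj hxy
  have deg_iff : ∀ w, (H.neighborSet w).ncard = 2 ↔ w = Sum.inl a ∨ w = Sum.inr 0 := by
    rintro (w | i)
    · constructor
      · intro h
        by_contra h2
        simp only [Sum.inl.injEq, reduceCtorEq, or_false] at h2
        exact dv w h2 h
      · rintro (h | h)
        · cases h; exact da
        · cases h
    · fin_cases i
      · simpa using d0
      · simpa using d1
  have sm := smoothing_adj H (by
    intro x y hx hy
    rw [deg_iff] at hx hy
    rcases hx with rfl | rfl <;> rcases hy with rfl | rfl <;> simp [Na, N0, Ne.symm nal, nal])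
  have sm2 : ∀ y z, (Smoothing H).Adj y z ↔ y.1 ≠ z.1 ∧ (H.Adj y.1 z.1 ∨
      (y.1 = Sum.inl p ∧ z.1 = Sum.inl b) ∨ (y.1 = Sum.inl b ∧ z.1 = Sum.inl p) ∨
      (y.1 = Sum.inl l ∧ z.1 = Sum.inr 1) ∨ (y.1 = Sum.inr 1 ∧ z.1 = Sum.inl l)) := by
    intro y z
    rw [sm]
    refine and_congr_right fun hyz => or_congr_right ?_
    constructor
    · rintro ⟨d, hd, h1, h2⟩
      rw [deg_iff] at hd
      rcases hd with rfl | rfl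
      · rw [adj_comm, Na] at h1
        rw [Na] at h2
        grind
      · rw [adj_comm, N0] at h1
        rw [N0] at h2
        grind
    · rintro (⟨h1, h2⟩ | ⟨h1, h2⟩ | ⟨h1, h2⟩ | ⟨h1, h2⟩)
      · exact ⟨Sum.inl a, da, by rw [adj_comm, Na]; tauto, by rw [Na]; tauto⟩
      · exact ⟨Sum.inl a, da, by rw [adj_comm, Na]; tauto, by rw [Na]; tauto⟩
      · exact ⟨Sum.inr 0, d0, by rw [adj_comm, N0]; tauto, by rw [N0]; tauto⟩
      · exact ⟨Sum.inr 0, d0, by rw [adj_comm, N0]; tauto, by rw [N0]; tauto⟩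
  let E : V → V ⊕ Fin 2 := fun v => if v = b then Sum.inr 1 else if v = a then Sum.inl b else
    Sum.inl (Equiv.swap l l' v)
  have Eb : E b = Sum.inr 1 := by simp [E]
  have Ea : E a = Sum.inl b := by simp [E, nab]
  have El : E l = Sum.inl l' := by simp [E, nlb, Ne.symm nal]
  have El' : E l' = Sum.inl l := by simp [E, Ne.symm nbl', Ne.symm nal']
  have Eo : ∀ v, v ≠ a → v ≠ b → v ≠ l → v ≠ l' → E v = Sum.inl v := by
    intro v h1 h2 h3 h4
    simp [E, h1, h2, Equiv.swap_apply_of_ne_of_ne h3 h4]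
  have hcases : ∀ v, v = a ∨ v = b ∨ v = l ∨ v = l' ∨
      (v ≠ a ∧ v ≠ b ∧ v ≠ l ∧ v ≠ l') := fun v => by tauto
  have hEdeg : ∀ v, (H.neighborSet (E v)).ncard ≠ 2 := by
    intro v
    rcases hcases v with rfl | rfl | rfl | rfl | ⟨h1, h2, h3, h4⟩
    · rw [Ea]; exact dv _ (Ne.symm nab)
    · rw [Eb]; exact d1
    · rw [El]; exact dv _ (Ne.symm nal')
    · rw [El']; exact dv _ (Ne.symm nal)
    · rw [Eo v h1 h2 h3 h4]; exact dv _ h1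
  have hinj : Function.Injective E := by
    intro u v huv
    rcases hcases u with rfl | rfl | rfl | rfl | ⟨h1, h2, h3, h4⟩ <;>
    rcases hcases v with rfl | rfl | rfl | rfl | ⟨k1, k2, k3, k4⟩ <;>
    (try simp only [Ea, Eb, El, El'] at huv) <;> grind
  have hsurj : ∀ w, (H.neighborSet w).ncard ≠ 2 → ∃ v, E v = w := by
    intro w hw
    rw [ne_eq, deg_iff, not_or] at hw
    rcases w with w | i
    · by_cases h1 : w = b
      · exact ⟨a, by rw [Ea, h1]⟩
      by_cases h2 : w = l
      · exact ⟨l', by rw [El', h2]⟩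
      by_cases h3 : w = l'
      · exact ⟨l, by rw [El, h3]⟩
      exact ⟨w, Eo w (by simpa using hw.1) h1 h2 h3⟩
    · fin_cases i
      · simp at hw
      · exact ⟨b, Eb⟩
  let e0 : V ≃ {w // (H.neighborSet w).ncard ≠ 2} := Equiv.ofBijective (fun v => ⟨E v, hEdeg v⟩)
    ⟨fun u v h => hinj (congrArg Subtype.val h), fun ⟨w, hw⟩ => by
      obtain ⟨v, hv⟩ := hsurj w hw
      exact ⟨v, Subtype.ext hv⟩⟩
  refine ⟨⟨e0, ?_⟩, ?_⟩
  · intro u v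
    rw [sm2]
    change E u ≠ E v ∧ (H.Adj (E u) (E v) ∨ (E u = _ ∧ E v = _) ∨ (E u = _ ∧ E v = _) ∨
      (E u = _ ∧ E v = _) ∨ (E u = _ ∧ E v = _)) ↔ _
    rw [hinj.ne_iff]
    have loop : ∀ w, ¬ H.Adj w w := fun w => H.loopless.irrefl w
    have loopT : ∀ w, ¬ T.graph.Adj w w := fun w => T.graph.loopless.irrefl w
    have hcases2 : ∀ v, v = a ∨ v = b ∨ v = l ∨ v = l' ∨
        ((v ≠ a ∧ v ≠ b ∧ v ≠ l ∧ v ≠ l') ∧ E v = Sum.inl v) := fun v => by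
      rcases hcases v with h | h | h | h | h
      · tauto
      · tauto
      · tauto
      · tauto
      · have := Eo v h.1 h.2.1 h.2.2.1 h.2.2.2
        tauto
    clear sm sm2 e0 hsurj hinj hEdeg hdeg deg_iff dv d1 d0 da N1 N0 Na hcases Eo H01 H10 Hl0 H0l
    clear_value E H
    rcases hcases2 u with rfl | rfl | rfl | rfl | ⟨h1, hEu⟩ <;>
    rcases hcases2 v with rfl | rfl | rfl | rfl | ⟨k1, hEv⟩ <;>
    (try rw [hEu]) <;> (try rw [hEv]) <;>
    simp only [Ea, Eb, El, El', Hll, Hl1, H1l, ha, hb, hl, hl',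
      ha2, hb2, hl2, hl2', Sum.inl.injEq, reduceCtorEq, Sym2.eq_iff, loop, loopT] <;>
    grind [SimpleGraph.Adj.ne]
  · intro v h1 h2
    change E v = _
    simp [E, h1, h2]

lemma swap_step {T T' : PhyloTree V X} (hne : [p, a, l, b, l', q].Nodup)
    (ha : ∀ v, T.graph.Adj a v ↔ v = p ∨ v = l ∨ v = b)
    (hb : ∀ v, T.graph.Adj b v ↔ v = a ∨ v = l' ∨ v = q)
    (hl : ∀ v, T.graph.Adj l v ↔ v = a)
    (hl' : ∀ v, T.graph.Adj l' v ↔ v = b)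
    (hg : T'.graph = T.graph) (hlf : ∃ x, T.leaf x = l)
    (hrel : ∀ x, T'.leaf x ≠ a ∧ T'.leaf x ≠ b ∧
      ((T'.leaf x = l ∧ T.leaf x = l') ∨ (T'.leaf x = l' ∧ T.leaf x = l) ∨
      (T'.leaf x ≠ l ∧ T'.leaf x ≠ l' ∧ T'.leaf x = T.leaf x))) :
    TBRStep T T' := by
  classical
  obtain ⟨e, he⟩ := swap_iso T hne ha hb hl hl' (by
    intro v
    by_cases h : ∃ x, T.leaf x = v
    · obtain ⟨x, rfl⟩ := h
      rw [T.leaf_deg]; omega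
    · push Not at h
      rw [T.internal_deg v h]; omega)
  simp only [List.nodup_cons, List.mem_cons, not_or, List.not_mem_nil, not_false_eq_true,
    List.nodup_nil, and_true] at hne
  have hab : (T.graph.deleteEdges {s(l, a)}).Adj a b := by
    rw [deleteEdges_adj, ha]
    simp only [Set.mem_singleton_iff, Sym2.eq_iff]
    grind
  have hbq : (T.graph.deleteEdges {s(l, a)}).Adj b q := by
    rw [deleteEdges_adj, hb]
    simp only [Set.mem_singleton_iff, Sym2.eq_iff]
    grind
  refine ⟨l, a, Sum.inr l, Sum.inl (b, q), (hl a).2 rfl, ⟨rfl, hlf⟩,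
    ⟨(hb q).2 (by simp), hab.reachable, hab.reachable.trans hbq.reachable⟩, ?_⟩
  rw [hg]
  refine ⟨e, fun x => ?_⟩
  obtain ⟨h1, h2, h3⟩ := hrel x
  rw [he _ h1 h2]
  rcases h3 with ⟨h3, h4⟩ | ⟨h3, h4⟩ | ⟨h3, h4, h5⟩
  · rw [h3, h4, Equiv.swap_apply_left]
  · rw [h3, h4, Equiv.swap_apply_right]
  · rw [Equiv.swap_apply_of_ne_of_ne h3 h4, h5]

end Swap


/-- The caterpillar: a path `0, …, n+1` with a leaf attached at every interior vertex. -/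
def cat (n : ℕ) : SimpleGraph (Fin (n + 2) ⊕ Fin n) where
  Adj
    | Sum.inl i, Sum.inl j => i.1 + 1 = j.1 ∨ j.1 + 1 = i.1
    | Sum.inl i, Sum.inr j => i.1 = j.1 + 1
    | Sum.inr j, Sum.inl i => i.1 = j.1 + 1
    | Sum.inr _, Sum.inr _ => False
  symm := ⟨by rintro (i | i) (j | j) h <;> simp at h ⊢ <;> omega⟩
  loopless := ⟨by rintro (i | i) h <;> simp at h⟩

@[simp] lemma cat_ll {n : ℕ} (i j : Fin (n + 2)) :
    (cat n).Adj (Sum.inl i) (Sum.inl j) ↔ i.1 + 1 = j.1 ∨ j.1 + 1 = i.1 := Iff.rfl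
@[simp] lemma cat_lr {n : ℕ} (i : Fin (n + 2)) (j : Fin n) :
    (cat n).Adj (Sum.inl i) (Sum.inr j) ↔ i.1 = j.1 + 1 := Iff.rfl
@[simp] lemma cat_rl {n : ℕ} (i : Fin (n + 2)) (j : Fin n) :
    (cat n).Adj (Sum.inr j) (Sum.inl i) ↔ i.1 = j.1 + 1 := Iff.rfl
@[simp] lemma cat_rr {n : ℕ} (i : Fin n) (j : Fin n) :
    (cat n).Adj (Sum.inr j) (Sum.inr i) ↔ False := Iff.rfl

lemma cat_connected (n : ℕ) : (cat n).Connected := by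
  have h : ∀ (k : ℕ) (hk : k < n + 2), (cat n).Reachable (Sum.inl 0) (Sum.inl ⟨k, hk⟩) := by
    intro k
    induction k with
    | zero => intro hk; exact Reachable.refl _
    | succ k ih =>
      intro hk
      exact (ih (by omega)).trans (Adj.reachable (by simp))
  have h2 : ∀ v, (cat n).Reachable (Sum.inl 0) v := by
    rintro (i | j)
    · exact h i.1 i.2
    · exact (h (j.1 + 1) (by omega)).trans (Adj.reachable (by simp))
  rw [connected_iff]
  exact ⟨fun u v => (h2 u).symm.trans (h2 v), ⟨Sum.inl 0⟩⟩

lemma cat_acyclic (n : ℕ) : (cat n).IsAcyclic := by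
  rw [isAcyclic_iff_forall_adj_isBridge]
  have h1 : ∀ i j : Fin (n + 2), i.1 + 1 = j.1 → (cat n).IsBridge s(Sum.inl i, Sum.inl j) := by
    intro i j hij
    rw [isBridge_iff]
    intro h
    have := reach_invariant (fun v => match v with
      | Sum.inl k => k.1 ≤ i.1
      | Sum.inr k => k.1 + 1 ≤ i.1) ?_ h (by simp)
    · simp at this; omega
    · rintro (u | u) (v | v) huv hu <;>
        simp [deleteEdges_adj, Fin.ext_iff] at huv hu ⊢ <;> omega
  have h2 : ∀ (i : Fin (n + 2)) (j : Fin n), i.1 = j.1 + 1 →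
      (cat n).IsBridge s(Sum.inr j, Sum.inl i) := by
    intro i j hij
    rw [isBridge_iff]
    intro h
    have := reach_invariant (fun v => v = Sum.inr j) ?_ h rfl
    · simp at this
    · rintro (u | u) (v | v) huv hu <;>
        simp [deleteEdges_adj, Fin.ext_iff] at huv hu ⊢ <;> omega
  rintro (u | u) (v | v) h
  · rcases h with h | h
    · exact h1 u v h
    · rw [Sym2.eq_swap]; exact h1 v u h
  · rw [Sym2.eq_swap]; exact h2 _ _ h
  · exact h2 _ _ h
  · exact h.elim

/-- Leaf labelling of the caterpillar. -/
def catLeaf (n : ℕ) (σ : Equiv.Perm (Fin n)) : Fin n ⊕ Fin 2 → Fin (n + 2) ⊕ Fin n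
  | Sum.inl i => Sum.inr (σ i)
  | Sum.inr j => Sum.inl (if j = 0 then 0 else Fin.last _)

/-- The caterpillar as a phylogenetic tree. -/
def catT (n : ℕ) (σ : Equiv.Perm (Fin n)) :
    PhyloTree (Fin (n + 2) ⊕ Fin n) (Fin n ⊕ Fin 2) where
  graph := cat n
  finite := inferInstance
  connected := cat_connected n
  leaf := catLeaf n σ
  leaf_inj := by
    rintro (i | i) (j | j) h
    · simpa [catLeaf] using h
    · simp [catLeaf] at h
    · simp [catLeaf] at h
    · fin_cases i <;> fin_cases j <;> simp [catLeaf, Fin.ext_iff] at h ⊢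
  leaf_deg := by
    rintro (i | i)
    · rw [Set.ncard_eq_one]
      refine ⟨Sum.inl (σ i).succ.castSucc, ?_⟩
      ext (v | v) <;> simp [catLeaf, Fin.ext_iff]
    · rw [Set.ncard_eq_one]
      fin_cases i
      · refine ⟨Sum.inl ⟨1, by omega⟩, ?_⟩
        change (cat n).neighborSet (Sum.inl ⟨0, by omega⟩) = _
        ext (v | v)
        · simp only [mem_neighborSet, cat_ll, Set.mem_singleton_iff, Sum.inl.injEq, Fin.ext_iff]
          omega
        · simp
      · refine ⟨Sum.inl (Fin.last n).castSucc, ?_⟩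
        ext (v | v) <;> simp [catLeaf, Fin.ext_iff] <;> omega
  internal_deg := by
    rintro (v | v) h
    · have h0 := h (Sum.inr 0)
      have h1 := h (Sum.inr 1)
      simp only [catLeaf, if_true, ne_eq, Sum.inl.injEq, Fin.ext_iff, one_ne_zero, if_false,
        Fin.val_zero, Fin.val_last] at h0 h1
      rw [Set.ncard_eq_three]
      refine ⟨Sum.inl ⟨v.1 - 1, by omega⟩, Sum.inl ⟨v.1 + 1, by omega⟩,
        Sum.inr ⟨v.1 - 1, by omega⟩, by simp, by simp, by simp, ?_⟩
      ext (w | w) <;> simp [Fin.ext_iff] <;> omega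
    · exact absurd (by simp [catLeaf]) (h (Sum.inl (σ.symm v)))
  acyclic := cat_acyclic n

lemma catT_step (n : ℕ) (σ : Equiv.Perm (Fin n)) (i j : Fin n) (hij : i.1 + 1 = j.1) :
    TBRStep (catT n σ) (catT n (Equiv.swap i j * σ)) := by
  have hi := i.2
  have hj := j.2
  refine swap_step (p := Sum.inl ⟨i.1, by omega⟩) (a := Sum.inl ⟨i.1 + 1, by omega⟩)
    (l := Sum.inr i) (b := Sum.inl ⟨i.1 + 2, by omega⟩) (l' := Sum.inr j)
    (q := Sum.inl ⟨i.1 + 3, by omega⟩) ?_ ?_ ?_ ?_ ?_ rfl ?_ ?_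
  · simp [Fin.ext_iff]; omega
  · rintro (v | v) <;> simp [catT, Fin.ext_iff] <;> omega
  · rintro (v | v) <;> simp [catT, Fin.ext_iff] <;> omega
  · rintro (v | v) <;> simp [catT, Fin.ext_iff]
  · rintro (v | v) <;> simp [catT, Fin.ext_iff]; omega
  · exact ⟨Sum.inl (σ.symm i), by simp [catT, catLeaf]⟩
  · rintro (x | x)
    · simp only [catT, catLeaf, Equiv.Perm.mul_apply, ne_eq, reduceCtorEq, not_false_eq_true,
        Sum.inr.injEq, true_and]
      by_cases h1 : σ x = i
      · simp [h1]
      by_cases h2 : σ x = j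
      · simp [h2]
      rw [Equiv.swap_apply_of_ne_of_ne h1 h2]
      tauto
    · fin_cases x <;> simp [catT, catLeaf, Fin.ext_iff] <;> omega

lemma catT_chain (n : ℕ) (σ : Equiv.Perm (Fin (n + 1))) : ∀ ρ : Equiv.Perm (Fin (n + 1)),
    ∃ k, tbrChain k ⟨_, catT (n + 1) ρ⟩ ⟨_, catT (n + 1) (σ * ρ)⟩ := by
  have hσ : σ ∈ Submonoid.closure
      (Set.range fun i : Fin n => Equiv.swap i.castSucc i.succ) := by
    rw [Equiv.Perm.mclosure_swap_castSucc_succ]; trivial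
  induction hσ using Submonoid.closure_induction_right with
  | one =>
    intro ρ
    exact ⟨0, by rw [one_mul]; exact ⟨Iso.refl, fun _ => rfl⟩⟩
  | mul_right x hx y hy ih =>
    intro ρ
    obtain ⟨i, rfl⟩ := hy
    obtain ⟨k, hk⟩ := ih (Equiv.swap i.castSucc i.succ * ρ)
    refine ⟨k + 1, ⟨_, catT (n + 1) (Equiv.swap i.castSucc i.succ * ρ)⟩, ?_, ?_⟩
    · exact catT_step _ _ _ _ (by simp)
    · rw [mul_assoc]; exact hk


/-- Exchange `2i` and `2i+1`. -/
def flipFun (m : ℕ) (i : Fin (2 * m)) : Fin (2 * m) :=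
  ⟨if i.1 % 2 = 0 then i.1 + 1 else i.1 - 1, by have := i.2; split_ifs <;> omega⟩

lemma flipFun_invol (m : ℕ) : Function.Involutive (flipFun m) := by
  intro i
  ext
  simp only [flipFun]
  split_ifs <;> omega

/-- The permutation exchanging `2i` and `2i+1`. -/
def flipPerm (m : ℕ) : Equiv.Perm (Fin (2 * m)) := (flipFun_invol m).toPerm

lemma flipPerm_val (m : ℕ) (i : Fin (2 * m)) :
    (flipPerm m i).1 = if i.1 % 2 = 0 then i.1 + 1 else i.1 - 1 := rfl

lemma flipPerm_flip (m : ℕ) (i : Fin (2 * m)) : flipPerm m (flipPerm m i) = i :=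
  flipFun_invol m i

/-- The character. -/
def chr (m : ℕ) : Fin (2 * m) ⊕ Fin 2 → ℕ
  | Sum.inl i => (i.1 + 1) / 2
  | Sum.inr j => if j = 0 then 0 else m

lemma good_one (m : ℕ) : Good (cat (2 * m)) (catLeaf (2 * m) 1) (chr m) (m + 1) := by
  let c : Fin (2 * m + 2) ⊕ Fin (2 * m) → ℕ := fun v => match v with
    | Sum.inl j => j.1 / 2
    | Sum.inr i => (i.1 + 1) / 2
  refine ⟨c, ?_, ?_, ?_⟩
  · rintro (v | v) <;> simp only [c] <;> omega
  · have hs : ∀ i j : Fin (2 * m + 2), i.1 / 2 = j.1 / 2 →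
        (monoG (cat (2 * m)) c).Reachable (Sum.inl i) (Sum.inl j) := by
      intro i j hij
      by_cases h : i = j
      · rw [h]
      · rw [Fin.ext_iff] at h
        exact Adj.reachable ⟨by rw [cat_ll]; omega, hij⟩
    have hr : ∀ v, ∃ j : Fin (2 * m + 2), c v = j.1 / 2 ∧
        (monoG (cat (2 * m)) c).Reachable v (Sum.inl j) := by
      rintro (j | i)
      · exact ⟨j, rfl, Reachable.refl _⟩
      · exact ⟨⟨i.1 + 1, by omega⟩, rfl, Adj.reachable ⟨by simp, rfl⟩⟩
    intro u v huv
    obtain ⟨i, hi, hi'⟩ := hr u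
    obtain ⟨j, hj, hj'⟩ := hr v
    exact (hi'.trans (hs i j (by omega))).trans hj'.symm
  · have : ∀ x, c (catLeaf (2 * m) 1 x) = chr m x := by
      rintro (i | j)
      · rfl
      · fin_cases j
        · simp [catLeaf, c, chr]
        · simp [catLeaf, c, chr]; omega
    intro x y
    rw [this, this]
    exact id

lemma spine_color {n : ℕ} {c : Fin (n + 2) ⊕ Fin n → ℕ} (hc : ConnCol (cat n) c) (x y : Fin n)
    (h : c (Sum.inr x) = c (Sum.inr y)) (J : Fin (n + 2)) (h1 : x.1 + 1 ≤ J.1) (h2 : J.1 < y.1 + 1) :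
    c (Sum.inl J) = c (Sum.inr x) := by
  by_contra hJ
  have := reach_invariant (G := monoG (cat n) c) (fun v => c v = c (Sum.inr x) ∧ match v with
      | Sum.inl k => k.1 < J.1
      | Sum.inr k => k.1 + 1 ≤ J.1) ?_ (hc _ _ h) ⟨rfl, h1⟩
  · have h3 := this.2
    simp only at h3
    omega
  · rintro u v ⟨huv, hcol⟩ ⟨hu1, hu2⟩
    refine ⟨hcol.symm.trans hu1, ?_⟩
    have hv : c v = c (Sum.inr x) := hcol.symm.trans hu1
    rcases u with u | u <;> rcases v with v | v
    · have : v ≠ J := by rintro rfl; exact hJ hv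
      simp only [ne_eq, Fin.ext_iff, cat_ll] at this huv hu2 ⊢
      omega
    · simp only [cat_lr] at huv hu2 ⊢
      omega
    · have : v ≠ J := by rintro rfl; exact hJ hv
      simp only [ne_eq, Fin.ext_iff, cat_rl] at this huv hu2 ⊢
      omega
    · exact huv.elim

lemma good_two (m q k : ℕ) (hq : 2 * q + 1 ≤ m)
    (h : Good (cat (2 * m)) (catLeaf (2 * m) (flipPerm m)) (chr m) k) : 3 * q ≤ k := by
  obtain ⟨c, hk, hc, hf⟩ := h
  let F : Fin (2 * m) → ℕ := fun p => ((flipPerm m p).1 + 1) / 2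
  have hF : ∀ p p' : Fin (2 * m), c (Sum.inr p) = c (Sum.inr p') → F p = F p' := by
    intro p p' h
    have := hf (Sum.inl (flipPerm m p)) (Sum.inl (flipPerm m p')) (by
      simpa only [catLeaf, flipPerm_flip] using h)
    exact this
  have key : ∀ t : Fin q, ∃ y : Fin 3 → Fin (2 * m),
      (∀ s s', c (Sum.inr (y s)) = c (Sum.inr (y s')) → s = s') ∧ ∀ s, (F (y s) - 1) / 2 = t.1 := by
    intro t
    have ht := t.2
    let p0 : Fin (2 * m) := ⟨4 * t.1, by omega⟩
    let p1 : Fin (2 * m) := ⟨4 * t.1 + 3, by omega⟩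
    let p2 : Fin (2 * m) := ⟨4 * t.1 + 2, by omega⟩
    let p3 : Fin (2 * m) := ⟨4 * t.1 + 5, by omega⟩
    have F0 : F p0 = 2 * t.1 + 1 := by
      simp only [F, flipPerm_val, p0]; split_ifs <;> omega
    have F1 : F p1 = 2 * t.1 + 1 := by
      simp only [F, flipPerm_val, p1]; split_ifs <;> omega
    have F2 : F p2 = 2 * t.1 + 2 := by
      simp only [F, flipPerm_val, p2]; split_ifs <;> omega
    have F3 : F p3 = 2 * t.1 + 2 := by
      simp only [F, flipPerm_val, p3]; split_ifs <;> omega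
    have n02 : c (Sum.inr p0) ≠ c (Sum.inr p2) := fun h => by have := hF _ _ h; omega
    have n03 : c (Sum.inr p0) ≠ c (Sum.inr p3) := fun h => by have := hF _ _ h; omega
    have n12 : c (Sum.inr p1) ≠ c (Sum.inr p2) := fun h => by have := hF _ _ h; omega
    by_cases h01 : c (Sum.inr p0) = c (Sum.inr p1)
    · have h23 : c (Sum.inr p2) ≠ c (Sum.inr p3) := by
        intro h23
        have e1 := spine_color hc p0 p1 h01 ⟨4 * t.1 + 3, by omega⟩ (by simp [p0]) (by simp [p1])
        have e2 := spine_color hc p2 p3 h23 ⟨4 * t.1 + 3, by omega⟩ (by simp [p2]) (by simp [p3])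
        exact n02 (e1.symm.trans e2)
      refine ⟨![p0, p2, p3], ?_, ?_⟩
      · intro s s' h
        fin_cases s <;> fin_cases s' <;> simp_all
      · intro s
        fin_cases s <;> simp [F0, F2, F3] <;> omega
    · refine ⟨![p0, p1, p2], ?_, ?_⟩
      · intro s s' h
        fin_cases s <;> fin_cases s' <;> simp_all
      · intro s
        fin_cases s <;> simp [F0, F1, F2] <;> omega
  choose y hy1 hy2 using key
  have hinj : Function.Injective (fun ts : Fin q × Fin 3 =>
      (⟨c (Sum.inr (y ts.1 ts.2)), hk _⟩ : Fin k)) := by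
    rintro ⟨t, s⟩ ⟨t', s'⟩ h
    have h1 : c (Sum.inr (y t s)) = c (Sum.inr (y t' s')) := congrArg Fin.val h
    have h2 := hF _ _ h1
    have h3 : t = t' := by
      ext
      rw [← hy2 t s, ← hy2 t' s', h2]
    subst h3
    rw [hy1 t s s' h1]
  have := Fintype.card_le_of_injective _ hinj
  simp at this
  omega

lemma dTBR_large (M m : ℕ) (hm : m = 2 * (M + 3) + 1) :
    M < dTBR (catT (2 * m) 1) (catT (2 * m) (flipPerm m)) := by
  have hne : {n | tbrChain n ⟨_, catT (2 * m) 1⟩ ⟨_, catT (2 * m) (flipPerm m)⟩}.Nonempty := by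
    obtain ⟨m', rfl⟩ : ∃ m', m = m' + 1 := ⟨m - 1, by omega⟩
    obtain ⟨k, hk⟩ := catT_chain (2 * m' + 1) (flipPerm (m' + 1)) 1
    rw [mul_one] at hk
    exact ⟨k, hk⟩
  have h1 := Nat.sInf_mem hne
  have h2 := good_chain (f := chr m) _ _ _ (m + 1) h1 (good_one m)
  have h3 := good_two m (M + 3) _ (by omega) h2
  change M < sInf _
  omega


/-- Path graph. -/
def pathG (N : ℕ) : SimpleGraph (Fin (N + 1)) where
  Adj i j := i.1 + 1 = j.1 ∨ j.1 + 1 = i.1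
  symm := ⟨by intro i j h; omega⟩
  loopless := ⟨by intro i h; omega⟩

lemma pathG_adj {N : ℕ} (i j : Fin (N + 1)) :
    (pathG N).Adj i j ↔ i.1 + 1 = j.1 ∨ j.1 + 1 = i.1 := Iff.rfl

lemma pathG_interval {N : ℕ} (a b : ℕ) (hab : a ≤ b) (haN : a ≤ N) (S : Set (Fin (N + 1)))
    (hS : S = {i | a ≤ i.1 ∧ i.1 ≤ b}) : ((pathG N).induce S).Connected := by
  subst hS
  have key : ∀ k : ℕ, ∀ hk : a + k < N + 1, ∀ hb : a + k ≤ b,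
      ((pathG N).induce {i : Fin (N + 1) | a ≤ i.1 ∧ i.1 ≤ b}).Reachable
        ⟨⟨a, by omega⟩, by simp; omega⟩ ⟨⟨a + k, hk⟩, by simp; omega⟩ := by
    intro k
    induction k with
    | zero => intro hk hb; exact Reachable.refl _
    | succ k ih =>
      intro hk hb
      refine (ih (by omega) (by omega)).trans (Adj.reachable ?_)
      simp [pathG_adj, SimpleGraph.comap_adj]
      omega
  have : Nonempty ({i : Fin (N + 1) | a ≤ i.1 ∧ i.1 ≤ b} : Set _) :=
    ⟨⟨⟨a, by omega⟩, by simp; omega⟩⟩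
  have key2 : ∀ x : ({i : Fin (N + 1) | a ≤ i.1 ∧ i.1 ≤ b} : Set _),
      ((pathG N).induce {i : Fin (N + 1) | a ≤ i.1 ∧ i.1 ≤ b}).Reachable
        ⟨⟨a, by omega⟩, by simp; omega⟩ x := by
    rintro ⟨⟨x, hx⟩, h1, h2⟩
    simp only at h1 h2
    obtain ⟨k, rfl⟩ := Nat.exists_eq_add_of_le h1
    exact key k hx h2
  exact ⟨fun x y => (key2 x).symm.trans (key2 y)⟩

lemma pathG_tree (N : ℕ) : (pathG N).IsTree := by
  refine ⟨?_, ?_⟩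
  · have h := pathG_interval (N := N) 0 N (Nat.zero_le _) (Nat.zero_le _) Set.univ
      (by ext i; simp; omega)
    have : Nonempty (Fin (N + 1)) := ⟨0⟩
    refine ⟨fun x y => ?_⟩
    exact (h.preconnected ⟨x, trivial⟩ ⟨y, trivial⟩).map (Embedding.induce Set.univ).toHom
  · rw [isAcyclic_iff_forall_adj_isBridge]
    have main : ∀ u v : Fin (N + 1), u.1 + 1 = v.1 → (pathG N).IsBridge s(u, v) := by
      intro u v h
      rw [isBridge_iff]
      intro hr
      have := reach_invariant (fun x : Fin (N + 1) => x.1 ≤ u.1) ?_ hr le_rfl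
      · omega
      · intro x y hxy hx
        simp only [deleteEdges_adj, pathG_adj, Set.mem_singleton_iff,
          Sym2.eq_iff, Fin.ext_iff] at hxy
        have hne : x ≠ y := by intro he; subst he; omega
        rw [Ne, Fin.ext_iff] at hne
        by_contra hc
        omega
    intro u v h
    rcases h with h | h
    · exact main u v h
    · rw [Sym2.eq_swap]; exact main v u h

lemma interval_tw {V : Type*} [Finite V] (G : SimpleGraph V) (N k : ℕ) (lo hi slot : V → ℕ)
    (h1 : ∀ v, lo v ≤ hi v) (h2 : ∀ v, lo v ≤ N)
    (h3 : ∀ u v, G.Adj u v → lo u ≤ hi v ∧ lo v ≤ hi u)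
    (h4 : ∀ v, slot v < k + 1)
    (h5 : ∀ u v, slot u = slot v → lo u ≤ hi v → lo v ≤ hi u → u = v) :
    HasTreeDecompWidthLE G k := by
  classical
  have := Fintype.ofFinite V
  refine ⟨N, pathG N, fun i => Finset.univ.filter (fun v => lo v ≤ i.1 ∧ i.1 ≤ hi v),
    pathG_tree N, ?_, ?_, ?_, ?_⟩
  · intro v
    exact ⟨⟨lo v, by have := h2 v; omega⟩, by simp [h1 v]⟩
  · intro u v h
    have := h3 u v h
    refine ⟨⟨max (lo u) (lo v), by have := h2 v; have := h2 u; omega⟩, ?_, ?_⟩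
    · simp [h1 u, this.2]
    · simp [h1 v, this.1]
  · intro v
    exact pathG_interval (lo v) (hi v) (h1 v) (h2 v) _ (by ext i; simp)
  · intro i
    have := Finset.card_le_card_of_injOn (s := Finset.univ.filter
      (fun v => lo v ≤ i.1 ∧ i.1 ≤ hi v)) (t := Finset.range (k + 1)) slot
      (by intro v _; simpa using h4 v)
      (by
        intro u hu v hv huv
        simp at hu hv
        exact h5 u v huv (by omega) (by omega))
    simpa using this

/-- Helly-type lemma for trees: a family of connected sets with a common vertex, and a
connected set meeting all of them. -/
lemma tree_helly {W ι : Type*} {t : SimpleGraph W} (ht : t.IsTree) (F : ι → Set W) (S : Set W)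
    (hF : ∀ i, (t.induce (F i)).Preconnected) (hS : (t.induce S).Connected)
    (hc : ∃ c, ∀ i, c ∈ F i) (hm : ∀ i, ∃ w ∈ F i, w ∈ S) :
    ∃ c ∈ S, ∀ i, c ∈ F i := by
  classical
  have hex : ∃ d : ℕ, ∃ c w, (∀ i, c ∈ F i) ∧ w ∈ S ∧ t.dist c w = d := by
    obtain ⟨c, hc⟩ := hc
    obtain ⟨w⟩ := hS.nonempty
    exact ⟨_, c, w.1, hc, w.2, rfl⟩
  obtain ⟨c, w, hcF, hwS, hd⟩ := Nat.find_spec hex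
  have hmin : ∀ c w, (∀ i, c ∈ F i) → w ∈ S → Nat.find hex ≤ t.dist c w :=
    fun c w h1 h2 => Nat.find_min' hex ⟨c, w, h1, h2, rfl⟩
  rw [← hd] at hmin
  by_cases h0 : c ∈ S
  · exact ⟨c, h0, hcF⟩
  exfalso
  obtain ⟨p, hp⟩ := ht.connected.exists_walk_length_eq_dist c w
  cases p with
  | nil => exact h0 hwS
  | @cons _ c' _ hadj q =>
    have hlt : t.dist c' w < t.dist c w := by
      rw [← hp, Walk.length_cons]
      have := dist_le q
      omega
    have hbr : ¬ (t \ fromEdgeSet {s(c, c')}).Reachable c c' := by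
      have := isAcyclic_iff_forall_adj_isBridge.1 ht.isAcyclic hadj
      rwa [isBridge_iff] at this
    -- sets avoiding c or c' stay on one side
    have side : ∀ A : Set W, (t.induce A).Preconnected → (c ∉ A ∨ c' ∉ A) →
        ∀ x ∈ A, ∀ y ∈ A, (t \ fromEdgeSet {s(c, c')}).Reachable x y := by
      intro A hA hcA x hx y hy
      have := reach_invariant (G := t.induce A)
        (fun z : A => (t \ fromEdgeSet {s(c, c')}).Reachable x z.1) ?_
        (hA ⟨x, hx⟩ ⟨y, hy⟩) (Reachable.refl _)
      · exact this
      · rintro ⟨u, hu⟩ ⟨v, hv⟩ huv hxu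
        refine hxu.trans (Adj.reachable ?_)
        have huv' : t.Adj u v := huv
        rw [sdiff_adj, fromEdgeSet_adj]
        refine ⟨huv', fun hh => ?_⟩
        simp only [Set.mem_singleton_iff, Sym2.eq_iff] at hh
        rcases hh.1 with ⟨rfl, rfl⟩ | ⟨rfl, rfl⟩ <;> tauto
    have hqc : c ∉ q.support := by
      intro hcq
      have h1 := dist_le (q.dropUntil c hcq)
      have h2 := q.length_dropUntil_le_length hcq
      rw [← hp, Walk.length_cons] at h1
      omega
    have hc'w : (t \ fromEdgeSet {s(c, c')}).Reachable c' w := by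
      have : ∀ e ∈ q.edges, e ∈ (t \ fromEdgeSet {s(c, c')}).edgeSet := by
        intro e he
        have het := q.edges_subset_edgeSet he
        rw [edgeSet_sdiff, edgeSet_fromEdgeSet]
        refine ⟨het, fun hh => ?_⟩
        have : e = s(c, c') := by simpa using hh.1
        subst this
        exact hqc (q.fst_mem_support_of_mem_edges he)
      exact ⟨q.transfer _ this⟩
    have hc'F : ∀ i, c' ∈ F i := by
      intro i
      by_contra hcon
      obtain ⟨x, hxF, hxS⟩ := hm i
      have h1 := side (F i) (hF i) (Or.inr hcon) c (hcF i) x hxF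
      have h2 := side S hS.preconnected (Or.inl h0) x hxS w hwS
      exact hbr ((h1.trans h2).trans hc'w.symm)
    have := hmin c' w hc'F hwS
    omega


lemma no_tw_two {V : Type*} (G : SimpleGraph V) (col : V → Fin 4)
    (a1 a2 b1 b2 c1 c2 d1 d2 d3 d4 d5 : V)
    (ha : G.Adj a1 a2) (hb : G.Adj b1 b2) (hc : G.Adj c1 c2)
    (hd1 : G.Adj d1 d2) (hd2 : G.Adj d2 d3) (hd3 : G.Adj d3 d4) (hd4 : G.Adj d4 d5)
    (hab : G.Adj a1 b1) (hac : G.Adj a2 c1) (had : G.Adj a1 d1) (hbc : G.Adj b1 c2)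
    (hbd : G.Adj b2 d5) (hcd : G.Adj c1 d2)
    (ca1 : col a1 = 0) (ca2 : col a2 = 0) (cb1 : col b1 = 1) (cb2 : col b2 = 1)
    (cc1 : col c1 = 2) (cc2 : col c2 = 2) (cd1 : col d1 = 3) (cd2 : col d2 = 3)
    (cd3 : col d3 = 3) (cd4 : col d4 = 3) (cd5 : col d5 = 3) :
    ¬ HasTreeDecompWidthLE G 2 := by
  classical
  rintro ⟨n, t, bag, ht, -, hE, hC, hcard⟩
  let N : V → Set (Fin (n + 1)) := fun v => {i | v ∈ bag i}
  have hN : ∀ v, (t.induce (N v)).Connected := hC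
  have hU : ∀ (S : Set (Fin (n + 1))) (v w : V), (t.induce S).Connected → N v ⊆ S → G.Adj v w →
      (t.induce (S ∪ N w)).Connected := by
    intro S v w hS hv hvw
    obtain ⟨i, h1, h2⟩ := hE v w hvw
    exact induce_union_connected hS.preconnected (hN w).preconnected ⟨i, hv h1, h2⟩
  have hA := hU (N a1) a1 a2 (hN a1) subset_rfl ha
  have hB := hU (N b1) b1 b2 (hN b1) subset_rfl hb
  have hCc := hU (N c1) c1 c2 (hN c1) subset_rfl hc
  have hD1 := hU (N d1) d1 d2 (hN d1) subset_rfl hd1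
  have hD2 := hU _ d2 d3 hD1 Set.subset_union_right hd2
  have hD3 := hU _ d3 d4 hD2 Set.subset_union_right hd3
  have hD := hU _ d4 d5 hD3 Set.subset_union_right hd4
  set A := N a1 ∪ N a2 with hAdef
  set B := N b1 ∪ N b2 with hBdef
  set C := N c1 ∪ N c2 with hCdef
  set D := N d1 ∪ N d2 ∪ N d3 ∪ N d4 ∪ N d5 with hDdef
  have mAB : ∃ w, w ∈ A ∧ w ∈ B := by
    obtain ⟨i, h1, h2⟩ := hE _ _ hab; exact ⟨i, Or.inl h1, Or.inl h2⟩
  have mAC : ∃ w, w ∈ A ∧ w ∈ C := by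
    obtain ⟨i, h1, h2⟩ := hE _ _ hac; exact ⟨i, Or.inr h1, Or.inl h2⟩
  have mAD : ∃ w, w ∈ A ∧ w ∈ D := by
    obtain ⟨i, h1, h2⟩ := hE _ _ had
    exact ⟨i, Or.inl h1, Or.inl (Or.inl (Or.inl (Or.inl h2)))⟩
  have mBC : ∃ w, w ∈ B ∧ w ∈ C := by
    obtain ⟨i, h1, h2⟩ := hE _ _ hbc; exact ⟨i, Or.inl h1, Or.inr h2⟩
  have mBD : ∃ w, w ∈ B ∧ w ∈ D := by
    obtain ⟨i, h1, h2⟩ := hE _ _ hbd; exact ⟨i, Or.inr h1, Or.inr h2⟩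
  have mCD : ∃ w, w ∈ C ∧ w ∈ D := by
    obtain ⟨i, h1, h2⟩ := hE _ _ hcd
    exact ⟨i, Or.inl h1, Or.inl (Or.inl (Or.inl (Or.inr h2)))⟩
  obtain ⟨x, hxC, hx⟩ := tree_helly ht ![A, B] C
    (by intro i; fin_cases i; exacts [hA.preconnected, hB.preconnected]) hCc
    (by obtain ⟨w, h1, h2⟩ := mAB
        exact ⟨w, by intro i; fin_cases i; exacts [h1, h2]⟩)
    (by intro i; fin_cases i; exacts [mAC, mBC])
  obtain ⟨y, hyD, hy⟩ := tree_helly ht ![A, B, C] D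
    (by intro i; fin_cases i; exacts [hA.preconnected, hB.preconnected, hCc.preconnected]) hD
    ⟨x, by intro i; fin_cases i; exacts [hx 0, hx 1, hxC]⟩
    (by intro i; fin_cases i; exacts [mAD, mBD, mCD])
  have hyA : y ∈ A := hy 0
  have hyB : y ∈ B := hy 1
  have hyC : y ∈ C := hy 2
  have hsub : (Finset.univ : Finset (Fin 4)) ⊆ (bag y).image col := by
    intro k _
    rw [Finset.mem_image]
    fin_cases k
    · rcases hyA with h | h
      exacts [⟨a1, h, ca1⟩, ⟨a2, h, ca2⟩]
    · rcases hyB with h | h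
      exacts [⟨b1, h, cb1⟩, ⟨b2, h, cb2⟩]
    · rcases hyC with h | h
      exacts [⟨c1, h, cc1⟩, ⟨c2, h, cc2⟩]
    · rcases hyD with (((h | h) | h) | h) | h
      exacts [⟨d1, h, cd1⟩, ⟨d2, h, cd2⟩, ⟨d3, h, cd3⟩, ⟨d4, h, cd4⟩, ⟨d5, h, cd5⟩]
  have h1 := Finset.card_le_card hsub
  have h2 := Finset.card_image_le (s := bag y) (f := col)
  have h3 := hcard y
  simp at h1
  omega

lemma mergeMap_leaf {V1 V2 X : Type*} (l1 : X → V1) (l2 : X → V2) (h2 : Function.Injective l2)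
    (x : X) : mergeMap l1 l2 (Sum.inr (l2 x)) = Sum.inl (l1 x) := by
  have h : ∃ y, l2 y = l2 x := ⟨x, rfl⟩
  have h' : h.choose = x := h2 h.choose_spec
  simp only [mergeMap, dif_pos h, h']

lemma mergeMap_nonleaf {V1 V2 X : Type*} (l1 : X → V1) (l2 : X → V2) (w : V2)
    (h : ¬ ∃ x, l2 x = w) : mergeMap l1 l2 (Sum.inr w) = Sum.inr w := by
  simp only [mergeMap, dif_neg h]

lemma mergeMap_inr_inj {V1 V2 X : Type*} (l1 : X → V1) (l2 : X → V2)
    (h1 : Function.Injective l1) (h2 : Function.Injective l2) (u v : V2)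
    (h : mergeMap l1 l2 (Sum.inr u) = mergeMap l1 l2 (Sum.inr v)) : u = v := by
  by_cases hu : ∃ x, l2 x = u <;> by_cases hv : ∃ x, l2 x = v
  · obtain ⟨x, rfl⟩ := hu
    obtain ⟨y, rfl⟩ := hv
    rw [mergeMap_leaf _ _ h2, mergeMap_leaf _ _ h2] at h
    rw [h1 (Sum.inl_injective h)]
  · obtain ⟨x, rfl⟩ := hu
    rw [mergeMap_leaf _ _ h2, mergeMap_nonleaf _ _ _ hv] at h
    simp at h
  · obtain ⟨y, rfl⟩ := hv
    rw [mergeMap_leaf _ _ h2, mergeMap_nonleaf _ _ _ hu] at h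
    simp at h
  · rw [mergeMap_nonleaf _ _ _ hv, mergeMap_nonleaf _ _ _ hu] at h
    exact Sum.inr_injective h

section disp
variable (m : ℕ)

lemma mm_l (i : Fin (2 * m)) :
    mergeMap (catLeaf (2 * m) 1) (catLeaf (2 * m) (flipPerm m)) (Sum.inr (Sum.inr i)) =
      Sum.inl (Sum.inr (flipPerm m i)) := by
  have := mergeMap_leaf (catLeaf (2 * m) 1) (catLeaf (2 * m) (flipPerm m))
    (catT (2 * m) (flipPerm m)).leaf_inj (Sum.inl (flipPerm m i))
  simpa [catLeaf, flipPerm_flip] using this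

lemma mm_zero (j : Fin (2 * m + 2)) (hj : j.1 = 0) :
    mergeMap (catLeaf (2 * m) 1) (catLeaf (2 * m) (flipPerm m)) (Sum.inr (Sum.inl j)) =
      Sum.inl (Sum.inl j) := by
  obtain rfl : j = 0 := Fin.ext hj
  exact mergeMap_leaf (catLeaf (2 * m) 1) (catLeaf (2 * m) (flipPerm m))
    (catT (2 * m) (flipPerm m)).leaf_inj (Sum.inr 0)

lemma mm_last (j : Fin (2 * m + 2)) (hj : j.1 = 2 * m + 1) :
    mergeMap (catLeaf (2 * m) 1) (catLeaf (2 * m) (flipPerm m)) (Sum.inr (Sum.inl j)) =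
      Sum.inl (Sum.inl j) := by
  obtain rfl : j = Fin.last _ := Fin.ext hj
  exact mergeMap_leaf (catLeaf (2 * m) 1) (catLeaf (2 * m) (flipPerm m))
    (catT (2 * m) (flipPerm m)).leaf_inj (Sum.inr 1)

lemma mm_mid (j : Fin (2 * m + 2)) (h0 : j.1 ≠ 0) (hj : j.1 ≠ 2 * m + 1) :
    mergeMap (catLeaf (2 * m) 1) (catLeaf (2 * m) (flipPerm m)) (Sum.inr (Sum.inl j)) =
      Sum.inr (Sum.inl j) := by
  apply mergeMap_nonleaf
  rintro ⟨x | x, hx⟩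
  · simp [catLeaf] at hx
  · simp only [catLeaf, Sum.inl.injEq] at hx
    split_ifs at hx
    · exact h0 (by rw [← hx]; rfl)
    · exact hj (by rw [← hx]; rfl)

/-- The display graph of our two caterpillars. -/
noncomputable abbrev dispG : SimpleGraph
    (DisplayVertex (catLeaf (2 * m) 1) (catLeaf (2 * m) (flipPerm m))) :=
  displayGraph (cat (2 * m)) (catLeaf (2 * m) 1) (cat (2 * m)) (catLeaf (2 * m) (flipPerm m))

/-- Embedding into the display graph. -/
noncomputable abbrev tD (u : (Fin (2 * m + 2) ⊕ Fin (2 * m)) ⊕ (Fin (2 * m + 2) ⊕ Fin (2 * m))) :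
    DisplayVertex (catLeaf (2 * m) 1) (catLeaf (2 * m) (flipPerm m)) :=
  toDisplay (catLeaf (2 * m) 1) (catLeaf (2 * m) (flipPerm m)) u

lemma disp_adj1 {u v : Fin (2 * m + 2) ⊕ Fin (2 * m)} (h : (cat (2 * m)).Adj u v) :
    (dispG m).Adj (tD m (Sum.inl u)) (tD m (Sum.inl v)) := by
  rw [dispG, displayGraph, fromRel_adj]
  refine ⟨fun he => ?_, Or.inl (Or.inl ⟨u, v, h, rfl, rfl⟩)⟩
  have := congrArg Subtype.val he
  exact h.ne (Sum.inl_injective this)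

lemma disp_adj2 {u v : Fin (2 * m + 2) ⊕ Fin (2 * m)} (h : (cat (2 * m)).Adj u v) :
    (dispG m).Adj (tD m (Sum.inr u)) (tD m (Sum.inr v)) := by
  rw [dispG, displayGraph, fromRel_adj]
  refine ⟨fun he => ?_, Or.inl (Or.inr ⟨u, v, h, rfl, rfl⟩)⟩
  have := congrArg Subtype.val he
  exact h.ne (mergeMap_inr_inj _ _ (catT (2 * m) 1).leaf_inj
    (catT (2 * m) (flipPerm m)).leaf_inj _ _ this)

lemma tD_l (i k : Fin (2 * m)) (h : (flipPerm m i).1 = k.1) :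
    tD m (Sum.inr (Sum.inr i)) = tD m (Sum.inl (Sum.inr k)) := by
  apply Subtype.ext
  have : flipPerm m i = k := Fin.ext h
  rw [← this]
  exact mm_l m i

lemma disp_lower (hm : 2 ≤ m) : ¬ HasTreeDecompWidthLE (dispG m) 2 := by
  let S : ∀ j : ℕ, j < 5 → Fin (2 * m + 2) := fun j hj => ⟨j, by omega⟩
  let L : ∀ j : ℕ, j < 4 → Fin (2 * m) := fun j hj => ⟨j, by omega⟩
  let s : ∀ j : ℕ, j < 5 → _ := fun j hj => tD m (Sum.inl (Sum.inl (S j hj)))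
  let l : ∀ j : ℕ, j < 4 → _ := fun j hj => tD m (Sum.inl (Sum.inr (L j hj)))
  let t : ∀ j : ℕ, j < 5 → _ := fun j hj => tD m (Sum.inr (Sum.inl (S j hj)))
  have t0 : t 0 (by omega) = s 0 (by omega) := Subtype.ext (mm_zero m _ rfl)
  have ss : ∀ j h h', (dispG m).Adj (s j h) (s (j + 1) h') := by
    intro j h h'
    exact disp_adj1 m (Or.inl rfl)
  have tt : ∀ j h h', (dispG m).Adj (t j h) (t (j + 1) h') := by
    intro j h h'
    exact disp_adj2 m (Or.inl rfl)
  have sl : ∀ j h h', (dispG m).Adj (s (j + 1) h') (l j h) := by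
    intro j h h'
    refine disp_adj1 m ?_
    simp [S, L]
  have tl : ∀ j k h h' h'', (flipPerm m (L j h)).1 = k →
      (dispG m).Adj (t (j + 1) h') (l k h'') := by
    intro j k h h' h'' he
    have := disp_adj2 m (u := Sum.inl (S (j + 1) h')) (v := Sum.inr (L j h)) (by simp [S, L])
    rwa [tD_l m _ (L k h'') he] at this
  let col : DisplayVertex (catLeaf (2 * m) 1) (catLeaf (2 * m) (flipPerm m)) → Fin 4 :=
    fun v => match v.1 with
    | Sum.inl (Sum.inl j) => if j.1 ≤ 1 then 0 else 1
    | Sum.inl (Sum.inr i) => if i.1 = 1 then 2 else 3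
    | Sum.inr (Sum.inl j) => if j.1 = 1 then 2 else 3
    | Sum.inr (Sum.inr _) => 0
  have cs : ∀ j h, col (s j h) = if j ≤ 1 then 0 else 1 := fun j h => rfl
  have cl : ∀ j h, col (l j h) = if j = 1 then 2 else 3 := fun j h => rfl
  have ct : ∀ j h, 1 ≤ j → col (t j h) = if j = 1 then 2 else 3 := by
    intro j h h1
    have : (t j h).1 = Sum.inr (Sum.inl (S j h)) :=
      mm_mid m _ (by simp [S]; omega) (by simp [S]; omega)
    simp only [col, this]
    simp [S]
  refine no_tw_two (dispG m) col (s 1 (by omega)) (s 0 (by omega)) (s 2 (by omega))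
    (s 3 (by omega)) (t 1 (by omega)) (l 1 (by omega)) (l 0 (by omega)) (t 2 (by omega))
    (t 3 (by omega)) (t 4 (by omega)) (l 2 (by omega))
    (ss 0 (by omega) (by omega)).symm (ss 2 (by omega) (by omega)) (tl 0 1 (by omega) (by omega) (by omega) (by rw [flipPerm_val]; simp [L]))
    (tl 1 0 (by omega) (by omega) (by omega) (by rw [flipPerm_val]; simp [L])).symm (tt 2 (by omega) (by omega)) (tt 3 (by omega) (by omega))
    (tl 3 2 (by omega) (by omega) (by omega) (by rw [flipPerm_val]; simp [L]))
    (ss 1 (by omega) (by omega)) (t0 ▸ tt 0 (by omega) (by omega)) (sl 0 (by omega) (by omega)) (sl 1 (by omega) (by omega)) (sl 2 (by omega) (by omega)) (tt 1 (by omega) (by omega))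
    ?_ ?_ ?_ ?_ ?_ ?_ ?_ ?_ ?_ ?_ ?_
  · exact cs 1 (by omega)
  · exact cs 0 (by omega)
  · exact cs 2 (by omega)
  · exact cs 3 (by omega)
  · exact ct 1 (by omega) (by omega)
  · exact cl 1 (by omega)
  · exact cl 0 (by omega)
  · exact ct 2 (by omega) (by omega)
  · exact ct 3 (by omega) (by omega)
  · exact ct 4 (by omega) (by omega)
  · exact cl 2 (by omega)

/-- Left interval end. -/
def loF : (Fin (2 * m + 2) ⊕ Fin (2 * m)) ⊕ (Fin (2 * m + 2) ⊕ Fin (2 * m)) → ℕ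
  | Sum.inl (Sum.inl j) => if j.1 % 2 = 1 then 2 * j.1 - 2 else 2 * j.1 - 3
  | Sum.inl (Sum.inr i) => if i.1 % 2 = 0 then 2 * i.1 + 3 else 2 * i.1 - 1
  | Sum.inr (Sum.inl j) => 2 * j.1 - 2
  | Sum.inr (Sum.inr _) => 0

/-- Right interval end. -/
def hiF : (Fin (2 * m + 2) ⊕ Fin (2 * m)) ⊕ (Fin (2 * m + 2) ⊕ Fin (2 * m)) → ℕ
  | Sum.inl (Sum.inl j) => if j.1 % 2 = 1 then 2 * j.1 + 1 else 2 * j.1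
  | Sum.inl (Sum.inr i) => if i.1 % 2 = 0 then 2 * i.1 + 3 else 2 * i.1 - 1
  | Sum.inr (Sum.inl j) => 2 * j.1
  | Sum.inr (Sum.inr _) => 0

/-- Slot in the bag. -/
def slotF : (Fin (2 * m + 2) ⊕ Fin (2 * m)) ⊕ (Fin (2 * m + 2) ⊕ Fin (2 * m)) → ℕ
  | Sum.inl (Sum.inl j) => if j.1 % 2 = 1 then 0 else 1
  | Sum.inl (Sum.inr i) => if i.1 % 2 = 0 then 2 else 3
  | Sum.inr (Sum.inl j) => if j.1 % 2 = 1 then 2 else 3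
  | Sum.inr (Sum.inr _) => 0

lemma lohi_t (j : Fin (2 * m + 2)) :
    loF m (tD m (Sum.inr (Sum.inl j))).1 = 2 * j.1 - 2 ∧
    2 * j.1 ≤ hiF m (tD m (Sum.inr (Sum.inl j))).1 := by
  by_cases h0 : j.1 = 0
  · have : (tD m (Sum.inr (Sum.inl j))).1 = _ := mm_zero m j h0
    rw [this]
    simp only [loF, hiF]
    split_ifs <;> omega
  by_cases h1 : j.1 = 2 * m + 1
  · have : (tD m (Sum.inr (Sum.inl j))).1 = _ := mm_last m j h1
    rw [this]
    simp only [loF, hiF]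
    split_ifs <;> omega
  · have : (tD m (Sum.inr (Sum.inl j))).1 = _ := mm_mid m j h0 h1
    rw [this]
    exact ⟨rfl, le_rfl⟩

lemma lohi_l (i : Fin (2 * m)) :
    loF m (tD m (Sum.inr (Sum.inr i))).1 = (if i.1 % 2 = 0 then 2 * i.1 + 1 else 2 * i.1 + 1) ∧
    hiF m (tD m (Sum.inr (Sum.inr i))).1 = 2 * i.1 + 1 := by
  have : (tD m (Sum.inr (Sum.inr i))).1 = _ := mm_l m i
  rw [this]
  simp only [loF, hiF, flipPerm_val]
  split_ifs <;> omega

lemma disp_upper : HasTreeDecompWidthLE (dispG m) 3 := by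
  have : Finite (DisplayVertex (catLeaf (2 * m) 1) (catLeaf (2 * m) (flipPerm m))) := by
    unfold DisplayVertex; infer_instance
  have rel : ∀ a b : DisplayVertex (catLeaf (2 * m) 1) (catLeaf (2 * m) (flipPerm m)),
      ((∃ u v, (cat (2 * m)).Adj u v ∧ a = tD m (Sum.inl u) ∧ b = tD m (Sum.inl v)) ∨
      (∃ u v, (cat (2 * m)).Adj u v ∧ a = tD m (Sum.inr u) ∧ b = tD m (Sum.inr v))) →
      loF m a.1 ≤ hiF m b.1 ∧ loF m b.1 ≤ hiF m a.1 := by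
    rintro a b (⟨u, v, h, rfl, rfl⟩ | ⟨u, v, h, rfl, rfl⟩)
    · change loF m (Sum.inl u) ≤ hiF m (Sum.inl v) ∧ loF m (Sum.inl v) ≤ hiF m (Sum.inl u)
      rcases u with u | u <;> rcases v with v | v <;>
        simp only [cat_ll, cat_lr, cat_rl, cat_rr] at h <;> simp only [loF, hiF]
      all_goals split_ifs <;> omega
    · rcases u with u | u <;> rcases v with v | v <;>
        simp only [cat_ll, cat_lr, cat_rl, cat_rr] at h
      · have h1 := lohi_t m u
        have h2 := lohi_t m v
        omega
      · have h1 := lohi_t m u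
        have h2 := lohi_l m v
        split_ifs at h2 <;> omega
      · have h1 := lohi_t m v
        have h2 := lohi_l m u
        split_ifs at h2 <;> omega
  have bad : ∀ i : Fin (2 * m), ¬ mergeMap (catLeaf (2 * m) 1) (catLeaf (2 * m) (flipPerm m))
      (Sum.inr (Sum.inr i)) = Sum.inr (Sum.inr i) := by
    intro i h
    rw [mm_l] at h
    simp at h
  refine interval_tw (dispG m) (2 * (2 * m)) 3 (fun v => loF m v.1) (fun v => hiF m v.1)
    (fun v => slotF m v.1) ?_ ?_ ?_ ?_ ?_
  · rintro ⟨(j | j) | (j | j), hj⟩ <;> simp only [loF, hiF] <;>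
      first | omega | (split_ifs <;> omega)
  · rintro ⟨(j | j) | (j | j), hj⟩ <;> simp only [loF] <;>
      first | omega | (split_ifs <;> omega)
  · intro u v h
    rw [dispG, displayGraph, fromRel_adj] at h
    rcases h.2 with h | h
    · exact rel u v h
    · exact (rel v u h).symm
  · rintro ⟨(j | j) | (j | j), hj⟩ <;> simp only [slotF] <;>
      first | omega | (split_ifs <;> omega)
  · rintro ⟨(j | j) | (j | j), hj⟩ ⟨(k | k) | (k | k), hk⟩ h1 h2 h3
    all_goals first
      | exact absurd hj (bad _)
      | exact absurd hk (bad _)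
      | skip
    all_goals simp only [slotF, loF, hiF] at h1 h2 h3
    all_goals apply Subtype.ext
    all_goals simp only [Sum.inl.injEq, Sum.inr.injEq, Fin.ext_iff, reduceCtorEq]
    all_goals split_ifs at h1 h2 h3 <;> omega

end disp

lemma dtw_flip (m : ℕ) (hm : 2 ≤ m) : dtw (catT (2 * m) 1) (catT (2 * m) (flipPerm m)) = 1 := by
  have hmono : ∀ j k, j ≤ k → HasTreeDecompWidthLE (dispG m) j →
      HasTreeDecompWidthLE (dispG m) k := by
    rintro j k hjk ⟨n, t, bag, h1, h2, h3, h4, h5⟩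
    exact ⟨n, t, bag, h1, h2, h3, h4, fun i => (h5 i).trans (by omega)⟩
  have hne : {k | HasTreeDecompWidthLE (dispG m) k}.Nonempty := ⟨3, disp_upper m⟩
  have h1 : treewidth (dispG m) ≤ 3 := Nat.sInf_le (disp_upper m)
  have h2 : HasTreeDecompWidthLE (dispG m) (treewidth (dispG m)) := Nat.sInf_mem hne
  have h3 : ¬ treewidth (dispG m) ≤ 2 := fun h => disp_lower m hm (hmono _ _ h h2)
  change treewidth (dispG m) - 2 = 1
  omega

/-- The gap between treewidth distance and TBR distance can be arbitrarily
large: for every `M` there is a pair of unrooted binary phylogenetic trees on a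
common label set with treewidth distance 1 and TBR distance greater than `M`. -/
theorem dtw_one_dTBR_unbounded :
    ∀ M : ℕ, ∃ (X V1 V2 : Type) (T1 : PhyloTree V1 X) (T2 : PhyloTree V2 X),
      3 ≤ Nat.card X ∧ dtw T1 T2 = 1 ∧ M < dTBR T1 T2 := by
  intro M
  refine ⟨_, _, _, catT (2 * (2 * (M + 3) + 1)) 1,
    catT (2 * (2 * (M + 3) + 1)) (flipPerm (2 * (M + 3) + 1)), ?_,
    dtw_flip _ (by omega), dTBR_large M _ rfl⟩
  simp
  omega
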